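/- arXiv:2406.05988 — 7 statements merged into one kernel-verified Lean document; each statement's English description precedes it below -/
import Mathlib

section
/- For every ε > 0, every n ≥ k ≥ 1, every sequence of click-through rates α₁ ≥ α₂ ≥ … ≥ α_k ≥ 0, and every public allowance profile γ ∈ [0,∞)ⁿ, there exists a deterministic truthful mechanism (π, p) such that for every value profile v ∈ (0,∞)ⁿ the social welfare at the truthful bids satisfies (1+ε)·Σ_i v_i·α_{π(v)(i)} ≥ OPT(v). (Positive part of Theorem 1: a truthful (1+ε)-approximate deterministic mechanism exists in the public allowance setting.) -/
open Finset

/-- CTR of slot `j` among `k` real slots; slot index `k` is the dummy slot with CTR `0`. -/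
noncomputable def ctr (k : ℕ) (α : Fin k → ℝ) (j : Fin (k + 1)) : ℝ :=
  if h : (j : ℕ) < k then α ⟨j, h⟩ else 0

/-- A feasible assignment: each non-dummy slot is assigned to at most one bidder. -/
def Feasible (n k : ℕ) (π : Fin n → Fin (k + 1)) : Prop :=
  ∀ i j : Fin n, π i = π j → (π i : ℕ) < k → i = j

/-- Social welfare of the assignment `π` under values `v`. -/
noncomputable def welfare (n k : ℕ) (α : Fin k → ℝ) (v : Fin n → ℝ)
    (π : Fin n → Fin (k + 1)) : ℝ :=
  ∑ i, v i * ctr k α (π i)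

/-- Optimal social welfare. -/
noncomputable def OPT (n k : ℕ) (α : Fin k → ℝ) (v : Fin n → ℝ) : ℝ :=
  sSup {w : ℝ | ∃ π : Fin n → Fin (k + 1), Feasible n k π ∧ w = welfare n k α v π}

/-- Truthfulness of a deterministic mechanism `(asg, pay)` in the public allowance setting
with allowance profile `γ`: individual rationality at the truthful bid, and no feasible
misreport of the value can improve the allowance utility. -/
def TruthfulPub (n k : ℕ) (α : Fin k → ℝ) (γ : Fin n → ℝ)
    (asg : (Fin n → ℝ) → Fin n → Fin (k + 1))
    (pay : (Fin n → ℝ) → Fin n → ℝ) : Prop :=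
  ∀ v : Fin n → ℝ, (∀ j, 0 < v j) → ∀ i : Fin n,
    pay v i ≤ v i * ctr k α (asg v i) ∧
    ∀ b : ℝ, 0 < b →
      pay (Function.update v i b) i ≤ v i * ctr k α (asg (Function.update v i b) i) →
      v i * ctr k α (asg v i) - max 0 (pay v i - γ i) ≥
        v i * ctr k α (asg (Function.update v i b) i)
          - max 0 (pay (Function.update v i b) i - γ i)

/-- Payments attached to the levels of a step allocation with thresholds `t` and levels `c`, for a
bidder with allowance `γ`: each level costs the smaller of the price that makes it just affordable
at its threshold and the price that makes it just as attractive there as the level below. -/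
noncomputable def stepPay (γ : ℝ) (t c : ℕ → ℝ) : ℕ → ℝ
  | 0 => 0
  | r + 1 => min (t (r + 1) * c (r + 1))
      (γ + max 0 (stepPay γ t c r - γ) + t (r + 1) * (c (r + 1) - c r))

section StepPay

variable {γ : ℝ} {t c : ℕ → ℝ}

lemma stepPay_le (ht : ∀ r, 0 ≤ t r) (hc : ∀ r, 0 ≤ c r) (r : ℕ) :
    stepPay γ t c r ≤ t r * c r := by
  cases r with
  | zero => exact mul_nonneg (ht 0) (hc 0)
  | succ r => exact min_le_left _ _

lemma stepPay_excess_succ_le (ht : ∀ r, 0 ≤ t r) (hmono : Monotone c) (r : ℕ) :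
    max 0 (stepPay γ t c (r + 1) - γ) ≤
      max 0 (stepPay γ t c r - γ) + t (r + 1) * (c (r + 1) - c r) := by
  have h1 : 0 ≤ t (r + 1) * (c (r + 1) - c r) :=
    mul_nonneg (ht _) (sub_nonneg.2 (hmono r.le_succ))
  have h2 : stepPay γ t c (r + 1) ≤ _ := min_le_right _ _
  apply max_le
  · linarith [le_max_left 0 (stepPay γ t c r - γ)]
  · linarith

lemma stepPay_utility_le_of_le (ht : ∀ r, 0 ≤ t r) (hmono : Monotone c) {v : ℝ} {l r : ℕ}
    (hlr : l ≤ r) (hv : ∀ s, l < s → s ≤ r → t s ≤ v) :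
    v * c l - max 0 (stepPay γ t c l - γ) ≤ v * c r - max 0 (stepPay γ t c r - γ) := by
  induction r, hlr using Nat.le_induction with
  | base => exact le_rfl
  | succ r hlr ih =>
    have h1 := ih fun s hs hsr => hv s hs (by omega)
    have h2 := stepPay_excess_succ_le (γ := γ) ht hmono r
    have h3 : t (r + 1) * (c (r + 1) - c r) ≤ v * (c (r + 1) - c r) :=
      mul_le_mul_of_nonneg_right (hv _ (by omega) le_rfl) (sub_nonneg.2 (hmono r.le_succ))
    linarith

lemma stepPay_utility_le_of_lt (hγ : 0 ≤ γ) (ht : ∀ r, 0 ≤ t r) (hc : ∀ r, 0 ≤ c r)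
    (hmono : Monotone c) {v : ℝ} {r l : ℕ} (hrl : r ≤ l)
    (hv : ∀ s, r < s → s ≤ l → v < t s) (hfeas : stepPay γ t c l ≤ v * c l) :
    v * c l - max 0 (stepPay γ t c l - γ) ≤ v * c r - max 0 (stepPay γ t c r - γ) := by
  induction l, hrl using Nat.le_induction with
  | base => exact le_rfl
  | succ l hrl ih =>
    have hvt : v < t (l + 1) := hv _ (by omega) le_rfl
    have hstep : 0 ≤ c (l + 1) - c l := sub_nonneg.2 (hmono l.le_succ)
    rcases (hc (l + 1)).eq_or_lt with h0 | hpos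
    · have hr0 : c r = 0 := le_antisymm (h0 ▸ hmono (by omega)) (hc r)
      have hp : stepPay γ t c r ≤ t r * c r := stepPay_le ht hc r
      rw [← h0, hr0]
      rw [hr0] at hp
      have : max 0 (stepPay γ t c r - γ) = 0 := max_eq_left (by linarith)
      linarith [le_max_left 0 (stepPay γ t c (l + 1) - γ)]
    · have hlt : stepPay γ t c (l + 1) < t (l + 1) * c (l + 1) :=
        hfeas.trans_lt (mul_lt_mul_of_pos_right hvt hpos)
      have heq : stepPay γ t c (l + 1) =
          γ + max 0 (stepPay γ t c l - γ) + t (l + 1) * (c (l + 1) - c l) := by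
        rcases min_choice (t (l + 1) * c (l + 1))
          (γ + max 0 (stepPay γ t c l - γ) + t (l + 1) * (c (l + 1) - c l)) with h | h
        · exact absurd h hlt.ne
        · exact h
      have hmul : v * (c (l + 1) - c l) ≤ t (l + 1) * (c (l + 1) - c l) :=
        mul_le_mul_of_nonneg_right hvt.le hstep
      have h1 := ih (fun s hs hsl => hv s hs (by omega))
        (by linarith [le_max_right 0 (stepPay γ t c l - γ)])
      linarith [le_max_right 0 (stepPay γ t c (l + 1) - γ)]

end StepPay

/-- The exponent of the largest power of `1 + ε` not exceeding a positive bid. -/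
noncomputable def bidLevel (ε x : ℝ) : ℤ := ⌊Real.logb (1 + ε) x⌋

lemma le_bidLevel_iff {ε x : ℝ} (hε : 0 < ε) (hx : 0 < x) (m : ℤ) :
    m ≤ bidLevel ε x ↔ (1 + ε) ^ m ≤ x := by
  rw [bidLevel, Int.le_floor, Real.le_logb_iff_rpow_le (by linarith) hx, Real.rpow_intCast]

/-- An upward closed nonempty condition on the bid level is a closed threshold on the bid. -/
lemma exists_threshold {ε : ℝ} (hε : 0 < ε) {Q : ℤ → Prop}
    (hQ : ∀ m m', m ≤ m' → Q m → Q m') (hne : ∃ m, Q m) :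
    ∃ t : ℝ, 0 ≤ t ∧ ∀ x, 0 < x → (Q (bidLevel ε x) ↔ t ≤ x) := by
  classical
  by_cases hb : ∃ b : ℤ, ∀ z, Q z → b ≤ z
  · obtain ⟨m, hm, hmin⟩ := Int.exists_least_of_bdd hb hne
    refine ⟨(1 + ε) ^ m, by positivity, fun x hx => ?_⟩
    rw [← le_bidLevel_iff hε hx]
    exact ⟨hmin _, fun h => hQ _ _ h hm⟩
  · push Not at hb
    refine ⟨0, le_rfl, fun x hx => ⟨fun _ => hx.le, fun _ => ?_⟩⟩
    obtain ⟨z, hz, hlt⟩ := hb (bidLevel ε x)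
    exact hQ _ _ hlt.le hz

/-- Click-through rates extended by `0` to all slot positions. -/
noncomputable def slotRate (k : ℕ) (α : Fin k → ℝ) (s : ℕ) : ℝ :=
  if h : s < k then α ⟨s, h⟩ else 0

lemma slotRate_nonneg {k : ℕ} {α : Fin k → ℝ} (hα : ∀ j, 0 ≤ α j) (s : ℕ) :
    0 ≤ slotRate k α s := by
  unfold slotRate
  split_ifs
  · exact hα _
  · exact le_rfl

lemma slotRate_antitone {k : ℕ} {α : Fin k → ℝ} (hα : ∀ j, 0 ≤ α j)
    (hmono : ∀ j j' : Fin k, j ≤ j' → α j' ≤ α j) : Antitone (slotRate k α) := by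
  intro s s' hs
  by_cases h : s' < k
  · simp only [slotRate, h, hs.trans_lt h, dite_true]
    exact hmono _ _ hs
  · have : slotRate k α s' = 0 := dif_neg h
    rw [this]
    exact slotRate_nonneg hα s

lemma slotRate_min (k : ℕ) (α : Fin k → ℝ) (s : ℕ) :
    slotRate k α (min k s) = slotRate k α s := by
  rcases le_total k s with h | h
  · rw [min_eq_left h, slotRate, slotRate, dif_neg (lt_irrefl k), dif_neg h.not_gt]
  · rw [min_eq_right h]

/-- If the number of competitors ahead of a bidder is an antitone function `N` of the bid level
that eventually vanishes, then some payments depending on the slot only are truthful. -/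
lemma exists_slotPay {ε : ℝ} (hε : 0 < ε) {k : ℕ} {α : Fin k → ℝ} (hα : ∀ j, 0 ≤ α j)
    (hmono : ∀ j j' : Fin k, j ≤ j' → α j' ≤ α j) {γ : ℝ} (hγ : 0 ≤ γ)
    {N : ℤ → ℕ} (hN : Antitone N) (hN0 : ∃ m, N m = 0) :
    ∃ p : ℕ → ℝ, ∀ v, 0 < v →
      p (min k (N (bidLevel ε v))) ≤ v * slotRate k α (min k (N (bidLevel ε v))) ∧
      ∀ b, 0 < b →
        p (min k (N (bidLevel ε b))) ≤ v * slotRate k α (min k (N (bidLevel ε b))) →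
        v * slotRate k α (min k (N (bidLevel ε b))) - max 0 (p (min k (N (bidLevel ε b))) - γ) ≤
          v * slotRate k α (min k (N (bidLevel ε v))) -
            max 0 (p (min k (N (bidLevel ε v))) - γ) := by
  have hthr : ∀ r : ℕ, ∃ t : ℝ, 0 ≤ t ∧ ∀ x, 0 < x → r ≤ k →
      (r ≤ k - min k (N (bidLevel ε x)) ↔ t ≤ x) := by
    intro r
    by_cases hr : r ≤ k
    · obtain ⟨t, ht, h⟩ := exists_threshold hε (Q := fun m => r ≤ k - min k (N m))
        (fun m m' hm h => by have := hN hm; omega)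
        (by obtain ⟨m, hm⟩ := hN0; exact ⟨m, by simp [hm, hr]⟩)
      exact ⟨t, ht, fun x hx _ => h x hx⟩
    · exact ⟨0, le_rfl, fun x _ h => absurd h hr⟩
  choose t ht htv using hthr
  set c : ℕ → ℝ := fun r => slotRate k α (k - r) with hcdef
  have hc : ∀ r, 0 ≤ c r := fun r => slotRate_nonneg hα _
  have hcm : Monotone c := fun r r' h => slotRate_antitone hα hmono (by omega)
  have hslot : ∀ x, slotRate k α (min k x) = c (k - min k x) := by
    intro x
    simp only [hcdef]
    congr 1
    omega
  refine ⟨fun s => stepPay γ t c (k - s), fun v hv => ?_⟩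
  simp only [hslot]
  have hvt : ∀ s, s ≤ k - min k (N (bidLevel ε v)) → t s ≤ v :=
    fun s hs => (htv s v hv (by omega)).1 hs
  have hvt' : ∀ s, s ≤ k → k - min k (N (bidLevel ε v)) < s → v < t s :=
    fun s hsk hs => not_le.1 fun h => absurd ((htv s v hv hsk).2 h) (by omega)
  refine ⟨(stepPay_le ht hc _).trans (mul_le_mul_of_nonneg_right (hvt _ le_rfl) (hc _)),
    fun b hb hfeas => ?_⟩
  rcases le_total (k - min k (N (bidLevel ε b))) (k - min k (N (bidLevel ε v))) with h | h
  · exact stepPay_utility_le_of_le ht hcm h fun s _ hs => hvt s hs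
  · exact stepPay_utility_le_of_lt hγ ht hc hcm h (fun s hs hs' => hvt' s (by omega) hs) hfeas

/-- Bidder `j` bidding at level `m'` is ahead of bidder `i` bidding at level `m`. -/
def Ahead {n : ℕ} (m' : ℤ) (j : Fin n) (m : ℤ) (i : Fin n) : Prop :=
  m < m' ∨ m = m' ∧ j < i

instance {n : ℕ} (m' : ℤ) (j : Fin n) (m : ℤ) (i : Fin n) : Decidable (Ahead m' j m i) :=
  inferInstanceAs (Decidable (m < m' ∨ m = m' ∧ j < i))

/-- The number of competitors ahead of bidder `i` if `i` bids at level `m`. -/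
noncomputable def numAhead {n : ℕ} (ε : ℝ) (b : Fin n → ℝ) (i : Fin n) (m : ℤ) : ℕ :=
  #{j | j ≠ i ∧ Ahead (bidLevel ε (b j)) j m i}

section NumAhead

variable {n : ℕ} {ε : ℝ}

lemma numAhead_update (b : Fin n → ℝ) (i : Fin n) (x : ℝ) :
    numAhead ε (Function.update b i x) i = numAhead ε b i := by
  funext m
  unfold numAhead
  congr 1
  refine Finset.filter_congr fun j _ => and_congr_right fun hj => ?_
  rw [Function.update_of_ne hj]

lemma numAhead_antitone (b : Fin n → ℝ) (i : Fin n) : Antitone (numAhead ε b i) := by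
  intro m m' hm
  refine Finset.card_le_card (Finset.monotone_filter_right _ fun j _ hj => ⟨hj.1, ?_⟩)
  have := hj.2
  unfold Ahead at *
  omega

lemma exists_numAhead_eq_zero (b : Fin n → ℝ) (i : Fin n) : ∃ m, numAhead ε b i m = 0 := by
  obtain ⟨M, hM⟩ := (Set.finite_range fun j => bidLevel ε (b j)).bddAbove
  refine ⟨M + 1, Finset.card_eq_zero.2 (Finset.filter_eq_empty_iff.2 fun j _ hj => ?_)⟩
  have h1 : bidLevel ε (b j) ≤ M := hM ⟨j, rfl⟩
  have := hj.2
  unfold Ahead at this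
  omega

/-- The number of bidders ahead of bidder `i`. -/
noncomputable def position (ε : ℝ) (b : Fin n → ℝ) (i : Fin n) : ℕ :=
  numAhead ε b i (bidLevel ε (b i))

lemma position_lt_of_ahead {b : Fin n → ℝ} {i j : Fin n}
    (h : Ahead (bidLevel ε (b j)) j (bidLevel ε (b i)) i) :
    position ε b j < position ε b i := by
  unfold position numAhead
  refine Finset.card_lt_card (Finset.ssubset_iff_of_subset ?_ |>.2 ⟨j, ?_, ?_⟩)
  · refine Finset.monotone_filter_right _ fun l _ hl => ?_
    have := hl.2
    unfold Ahead at *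
    refine ⟨?_, by omega⟩
    rintro rfl
    omega
  · simp only [Finset.mem_filter, Finset.mem_univ, true_and]
    refine ⟨?_, h⟩
    rintro rfl
    unfold Ahead at h
    omega
  · simp

lemma position_injective (b : Fin n → ℝ) : Function.Injective (position ε b) := by
  intro i j h
  by_contra hne
  have : Ahead (bidLevel ε (b j)) j (bidLevel ε (b i)) i ∨
      Ahead (bidLevel ε (b i)) i (bidLevel ε (b j)) j := by
    unfold Ahead
    omega
  rcases this with h' | h'
  · exact (position_lt_of_ahead h').ne' h
  · exact (position_lt_of_ahead h').ne h

lemma bidLevel_le_of_position_lt {b : Fin n → ℝ} {i j : Fin n}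
    (h : position ε b j < position ε b i) : bidLevel ε (b i) ≤ bidLevel ε (b j) := by
  by_contra! hlt
  exact (position_lt_of_ahead (Or.inl hlt)).not_gt h

lemma position_lt (b : Fin n → ℝ) (i : Fin n) : position ε b i < n := by
  have : position ε b i < #(univ : Finset (Fin n)) := by
    unfold position numAhead
    exact Finset.card_lt_card (Finset.ssubset_iff_of_subset (Finset.filter_subset _ _) |>.2
      ⟨i, by simp, by simp⟩)
  simpa using this

end NumAhead

/-- Serving bidders in an order along which weights decrease maximizes weighted click-through. -/
lemma welfare_le_of_position {n k : ℕ} (hkn : k ≤ n) {α : Fin k → ℝ} (hα : ∀ j, 0 ≤ α j)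
    (hmono : ∀ j j' : Fin k, j ≤ j' → α j' ≤ α j) {w : Fin n → ℝ} (hw : ∀ i, 0 ≤ w i)
    {pos : Fin n → ℕ} (hinj : Function.Injective pos) (hlt : ∀ i, pos i < n)
    (hpos : ∀ i j, pos j < pos i → w i ≤ w j)
    {π : Fin n → Fin (k + 1)} (hπ : Feasible n k π) :
    welfare n k α w π ≤ ∑ i, w i * slotRate k α (pos i) := by
  classical
  let e : Fin n ≃ Fin n := Equiv.ofBijective (fun i => ⟨pos i, hlt i⟩)
    (Finite.injective_iff_bijective.1 fun i j h => hinj (Fin.mk.inj_iff.1 h))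
  have he : ∀ i, (e i : ℕ) = pos i := fun i => rfl
  obtain ⟨σ, hσ⟩ : ∃ σ : Fin n ≃ Fin n, ∀ i, (π i : ℕ) < k → (σ i : ℕ) = π i := by
    let f : {i // (π i : ℕ) < k} → Fin n := fun i => ⟨π i, i.2.trans_le hkn⟩
    have hf : Function.Injective f := fun i j h =>
      Subtype.ext (hπ i j (Fin.ext (Fin.mk.inj_iff.1 h)) i.2)
    let g := Equiv.ofInjective f hf
    refine ⟨g.extendSubtype, fun i hi => ?_⟩
    rw [Equiv.extendSubtype_apply_of_mem g i hi]
    rfl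
  have hmv : Monovary w (fun i => slotRate k α (pos i)) := by
    intro i j h
    refine hpos i j ?_
    by_contra! hle
    exact (slotRate_antitone hα hmono hle).not_gt h
  calc welfare n k α w π ≤ ∑ i, w i * slotRate k α (pos ((σ.trans e.symm) i)) := by
        refine Finset.sum_le_sum fun i _ => mul_le_mul_of_nonneg_left ?_ (hw i)
        have : pos ((σ.trans e.symm) i) = σ i := by rw [← he]; simp
        rw [this]
        by_cases hi : (π i : ℕ) < k
        · rw [hσ i hi]
          exact le_rfl
        · rw [ctr, dif_neg hi]
          exact slotRate_nonneg hα _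
    _ ≤ _ := hmv.sum_mul_comp_perm_le_sum_mul

/-- Positive part of Theorem 1: in the public allowance setting there is a deterministic
truthful mechanism whose welfare at the truthful bids is a `(1+ε)`-approximation of `OPT`. -/
theorem public_allowance_upper_bound (ε : ℝ) (hε : 0 < ε) (n k : ℕ)
    (hk : 1 ≤ k) (hkn : k ≤ n)
    (α : Fin k → ℝ) (hα : ∀ j, 0 ≤ α j)
    (hmono : ∀ j j' : Fin k, j ≤ j' → α j' ≤ α j)
    (γ : Fin n → ℝ) (hγ : ∀ i, 0 ≤ γ i) :
    ∃ (asg : (Fin n → ℝ) → Fin n → Fin (k + 1)) (pay : (Fin n → ℝ) → Fin n → ℝ),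
      (∀ b : Fin n → ℝ, Feasible n k (asg b)) ∧
      TruthfulPub n k α γ asg pay ∧
      ∀ v : Fin n → ℝ, (∀ i, 0 < v i) →
        (1 + ε) * welfare n k α v (asg v) ≥ OPT n k α v := by
  have hpay : ∀ (i : Fin n) (N : ℤ → ℕ), ∃ p : ℕ → ℝ, Antitone N → (∃ m, N m = 0) →
      ∀ v, 0 < v →
      p (min k (N (bidLevel ε v))) ≤ v * slotRate k α (min k (N (bidLevel ε v))) ∧
      ∀ b, 0 < b →
        p (min k (N (bidLevel ε b))) ≤ v * slotRate k α (min k (N (bidLevel ε b))) →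
        v * slotRate k α (min k (N (bidLevel ε b))) -
            max 0 (p (min k (N (bidLevel ε b))) - γ i) ≤
          v * slotRate k α (min k (N (bidLevel ε v))) -
            max 0 (p (min k (N (bidLevel ε v))) - γ i) := by
    intro i N
    by_cases h : Antitone N ∧ ∃ m, N m = 0
    · obtain ⟨p, hp⟩ := exists_slotPay hε hα hmono (hγ i) h.1 h.2
      exact ⟨p, fun _ _ => hp⟩
    · exact ⟨0, fun h1 h2 => absurd ⟨h1, h2⟩ h⟩
  choose P hP using hpay
  let asg : (Fin n → ℝ) → Fin n → Fin (k + 1) := fun b i =>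
    ⟨min k (position ε b i), Nat.lt_succ_of_le (min_le_left _ _)⟩
  have hfeas : ∀ b, Feasible n k (asg b) := by
    intro b i j h hi
    refine position_injective (ε := ε) b ?_
    have h1 : min k (position ε b i) = min k (position ε b j) := Fin.mk.inj_iff.1 h
    have h2 : min k (position ε b i) < k := hi
    omega
  have hctr : ∀ b i, ctr k α (asg b i) = slotRate k α (min k (position ε b i)) :=
    fun b i => rfl
  refine ⟨asg, fun b i => P i (numAhead ε b i) (min k (position ε b i)), hfeas, ?_, ?_⟩
  · intro v hv i
    obtain ⟨hir, hic⟩ := hP i (numAhead ε v i) (numAhead_antitone v i)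
      (exists_numAhead_eq_zero v i) (v i) (hv i)
    refine ⟨hir, fun b hb hfb => ?_⟩
    have hpos : position ε (Function.update v i b) i = numAhead ε v i (bidLevel ε b) := by
      rw [position, numAhead_update, Function.update_self]
    simp only [hctr, hpos, numAhead_update] at hfb ⊢
    exact hic b hb hfb
  · intro v hv
    have hpow : ∀ i, (1 + ε) ^ bidLevel ε (v i) ≤ v i :=
      fun i => (le_bidLevel_iff hε (hv i) _).1 le_rfl
    have hpow' : ∀ i, v i ≤ (1 + ε) * (1 + ε) ^ bidLevel ε (v i) := by
      intro i
      have h : v i < (1 + ε) ^ (bidLevel ε (v i) + 1) :=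
        not_le.1 fun h => absurd ((le_bidLevel_iff hε (hv i) _).2 h) (by omega)
      rw [zpow_add_one₀ (by positivity), mul_comm] at h
      exact h.le
    have hctr0 : ∀ j, 0 ≤ ctr k α j := fun j => slotRate_nonneg hα j
    refine csSup_le ⟨_, asg v, hfeas v, rfl⟩ ?_
    rintro _ ⟨π, hπ, rfl⟩
    have hopt := welfare_le_of_position hkn hα hmono
      (w := fun i => (1 + ε) ^ bidLevel ε (v i)) (fun i => by positivity)
      (position_injective (ε := ε) v) (position_lt v)
      (fun i j h => zpow_le_zpow_right₀ (by linarith) (bidLevel_le_of_position_lt h)) hπ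
    calc welfare n k α v π
        ≤ (1 + ε) * welfare n k α (fun i => (1 + ε) ^ bidLevel ε (v i)) π := by
          rw [welfare, welfare, Finset.mul_sum]
          refine Finset.sum_le_sum fun i _ => ?_
          rw [← mul_assoc]
          exact mul_le_mul_of_nonneg_right (hpow' i) (hctr0 _)
      _ ≤ (1 + ε) * ∑ i, (1 + ε) ^ bidLevel ε (v i) * slotRate k α (position ε v i) :=
          mul_le_mul_of_nonneg_left hopt (by positivity)
      _ ≤ (1 + ε) * welfare n k α v (asg v) := by
          refine mul_le_mul_of_nonneg_left (Finset.sum_le_sum fun i _ => ?_) (by positivity)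
          rw [hctr, slotRate_min]
          exact mul_le_mul_of_nonneg_right (hpow i) (slotRate_nonneg hα _)
end

section
/- For every deterministic truthful mechanism (W, p) in the two-bidder single-slot setting with both allowances equal to 1/2, there exist ε > 0 and a value profile (v₁, v₂) ∈ (0,∞)² such that the achieved social welfare (v_{W(v₁,v₂)} if W(v₁,v₂) ∈ {1,2}, and 0 if the slot is unassigned) is at most max(v₁, v₂)/(1+ε). In particular, no deterministic truthful mechanism can guarantee (1+ε)-approximation for arbitrarily small ε > 0. -/
/-- Truthfulness of a two-bidder single-slot deterministic mechanism with winner rule `W`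
(`W b₁ b₂ = 0` means the slot stays unassigned, `1`/`2` name the winner) and payment rule
`p` (charged to the winner), where both bidders have public allowance `1/2`. -/
def TruthfulTwo (W : ℝ → ℝ → ℕ) (p : ℝ → ℝ → ℝ) : Prop :=
  -- bidder 1
  (∀ v : ℝ, 0 < v → ∀ b₂ : ℝ, 0 < b₂ →
    (W v b₂ = 1 → p v b₂ ≤ v) ∧
    (∀ b' : ℝ, 0 < b' →
      (W b' b₂ = 1 → p b' b₂ ≤ v →
        (if W v b₂ = 1 then v - max 0 (p v b₂ - 1/2) else 0) ≥
          v - max 0 (p b' b₂ - 1/2)) ∧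
      (W b' b₂ ≠ 1 →
        (if W v b₂ = 1 then v - max 0 (p v b₂ - 1/2) else 0) ≥ 0))) ∧
  -- bidder 2
  (∀ v : ℝ, 0 < v → ∀ b₁ : ℝ, 0 < b₁ →
    (W b₁ v = 2 → p b₁ v ≤ v) ∧
    (∀ b' : ℝ, 0 < b' →
      (W b₁ b' = 2 → p b₁ b' ≤ v →
        (if W b₁ v = 2 then v - max 0 (p b₁ v - 1/2) else 0) ≥
          v - max 0 (p b₁ b' - 1/2)) ∧
      (W b₁ b' ≠ 2 →
        (if W b₁ v = 2 then v - max 0 (p b₁ v - 1/2) else 0) ≥ 0)))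

/-- A bidder facing a fixed opponent bid, with win region `w` and payments `q`: if truthful
bidding is optimal and she wins at every value above some `b ≥ 1/2`, then she also wins at `b`. -/
lemma wins_at_threshold (w : ℝ → Prop) [DecidablePred w] (q : ℝ → ℝ) {b : ℝ} (hb : 1 / 2 ≤ b)
    (ir : ∀ v, 0 < v → w v → q v ≤ v)
    (ic : ∀ v, 0 < v → ∀ b', 0 < b' → w b' → q b' ≤ v →
      v - max 0 (q b' - 1 / 2) ≤ if w v then v - max 0 (q v - 1 / 2) else 0)
    (hw : ∀ v, b < v → w v) : w b := by
  by_contra hlose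
  have hw₁ : w (b + 1) := hw _ (by linarith)
  have hir₁ := ir (b + 1) (by linarith) hw₁
  have hq : b < q (b + 1) := by
    by_contra! hle
    have hdev := ic b (by linarith) (b + 1) (by linarith) hw₁ hle
    rw [if_neg hlose] at hdev
    have : max 0 (q (b + 1) - 1 / 2) < b := max_lt (by linarith) (by linarith)
    linarith
  obtain ⟨v, hbv, hvq⟩ := exists_between hq
  have hwv := hw v hbv
  have hirv := ir v (by linarith) hwv
  have hdev := ic (b + 1) (by linarith) v (by linarith) hwv (by linarith)
  rw [if_pos hw₁] at hdev
  have : max 0 (q v - 1 / 2) < q (b + 1) - 1 / 2 := max_lt (by linarith) (by linarith)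
  linarith [le_max_right 0 (q (b + 1) - 1 / 2)]

lemma exists_pos_le_div_one_add {a m : ℝ} (ha : 0 ≤ a) (ham : a < m) :
    ∃ ε : ℝ, 0 < ε ∧ a ≤ m / (1 + ε) := by
  refine ⟨(m - a) / (a + 1), div_pos (by linarith) (by linarith), ?_⟩
  rw [le_div_iff₀ (by have := div_pos (sub_pos.2 ham) (by linarith : 0 < a + 1); linarith)]
  have : a * ((m - a) / (a + 1)) ≤ m - a := by
    rw [← mul_div_assoc, div_le_iff₀ (by linarith)]
    nlinarith
  linarith

/-- Lemma 2 (lower bound): every deterministic truthful mechanism for two bidders with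
allowances `1/2` competing for a single slot of CTR `1` fails to be a
`(1+ε)`-approximation for some `ε > 0` at some positive value profile. -/
theorem public_allowance_lower_bound (W : ℝ → ℝ → ℕ) (p : ℝ → ℝ → ℝ)
    (hW : ∀ b₁ b₂ : ℝ, W b₁ b₂ = 0 ∨ W b₁ b₂ = 1 ∨ W b₁ b₂ = 2)
    (h : TruthfulTwo W p) :
    ∃ ε : ℝ, 0 < ε ∧ ∃ v₁ v₂ : ℝ, 0 < v₁ ∧ 0 < v₂ ∧
      (if W v₁ v₂ = 1 then v₁ else if W v₁ v₂ = 2 then v₂ else 0) ≤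
        max v₁ v₂ / (1 + ε) := by
  by_contra! hne
  have efficient : ∀ v₁ v₂ : ℝ, 0 < v₁ → 0 < v₂ →
      max v₁ v₂ ≤ if W v₁ v₂ = 1 then v₁ else if W v₁ v₂ = 2 then v₂ else 0 := by
    intro v₁ v₂ h₁ h₂
    by_contra! hlt
    obtain ⟨ε, hε, hle⟩ := exists_pos_le_div_one_add (by split_ifs <;> linarith) hlt
    exact (hne ε hε v₁ v₂ h₁ h₂).not_ge hle
  obtain ⟨h₁, h₂⟩ := h
  have win₁ : W 1 1 = 1 := by
    refine wins_at_threshold (fun v => W v 1 = 1) (fun v => p v 1) (by norm_num)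
      (fun v hv => (h₁ v hv 1 one_pos).1)
      (fun v hv b' hb' => ((h₁ v hv 1 one_pos).2 b' hb').1) fun v hv => ?_
    by_contra hlose
    have := efficient v 1 (by linarith) one_pos
    rw [if_neg hlose] at this
    have := le_max_left v 1
    split_ifs at * <;> linarith
  have win₂ : W 1 1 = 2 := by
    refine wins_at_threshold (fun v => W 1 v = 2) (fun v => p 1 v) (by norm_num)
      (fun v hv => (h₂ v hv 1 one_pos).1)
      (fun v hv b' hb' => ((h₂ v hv 1 one_pos).2 b' hb').1) fun v hv => ?_
    by_contra hlose
    have := efficient 1 v one_pos (by linarith)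
    rw [if_neg hlose] at this
    have := le_max_right 1 v
    split_ifs at * <;> linarith
  omega
end

section
/- For every ε ∈ (0,1), every n ≥ k ≥ 1 with n ≥ 2, and every sequence of CTRs α₁ ≥ … ≥ α_k ≥ 0, there exists a universally truthful randomized mechanism (a finite probability space (Ω, μ) together with a deterministic truthful mechanism M_ω for each ω ∈ Ω) such that for every true profile (v, γ) ∈ (0,∞)ⁿ × [0,∞)ⁿ, the expected social welfare at the truthful report, Σ_ω μ(ω)·Σ_i v_i·α_{π_ω(v,γ)(i)}, is at least OPT(v)/((49 + 8√3)·(1+ε)). In particular, in the private allowance setting there exists a truthful mechanism with constant approximation ratio. -/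
open Finset

/-- Truthfulness of a deterministic mechanism `(asg, pay)` in the private allowance setting:
for every bidder `i` with true value `v i > 0` and true allowance `γ i ≥ 0` (and any reports
of the other bidders), individual rationality holds at the truthful report, and no feasible
misreport `(b', g')` can improve the allowance utility. -/
def TruthfulPriv (n k : ℕ) (α : Fin k → ℝ)
    (asg : (Fin n → ℝ) → (Fin n → ℝ) → Fin n → Fin (k + 1))
    (pay : (Fin n → ℝ) → (Fin n → ℝ) → Fin n → ℝ) : Prop :=
  ∀ v γ : Fin n → ℝ, (∀ j, 0 < v j) → (∀ j, 0 ≤ γ j) → ∀ i : Fin n,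
    pay v γ i ≤ v i * ctr k α (asg v γ i) ∧
    ∀ b' g' : ℝ, 0 < b' → 0 ≤ g' →
      (pay (Function.update v i b') (Function.update γ i g') i ≤
        v i * ctr k α (asg (Function.update v i b') (Function.update γ i g') i)) →
      v i * ctr k α (asg v γ i) - max 0 (pay v γ i - γ i) ≥
        v i * ctr k α (asg (Function.update v i b') (Function.update γ i g') i)
          - max 0 (pay (Function.update v i b') (Function.update γ i g') i - γ i)

/-- The values of `x` listed in decreasing order. -/
noncomputable def decreasingSort {n : ℕ} (x : Fin n → ℝ) : Fin n → ℝ :=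
  x ∘ Tuple.sort (fun i => -x i)

theorem decreasingSort_antitone {n : ℕ} (x : Fin n → ℝ) : Antitone (decreasingSort x) := by
  intro a b hab
  have := Tuple.monotone_sort (fun i => -x i) hab
  simp only [Function.comp_apply, neg_le_neg_iff] at this
  exact this

theorem le_decreasingSort {n : ℕ} (x : Fin n → ℝ) (t : ℝ) (r : Fin n)
    (h : (r : ℕ) < #{i | t ≤ x i}) : t ≤ decreasingSort x r :=
  (Tuple.lt_card_ge_iff_apply_ge_of_antitone (decreasingSort_antitone x)).1 <|
    h.trans_eq (Finset.card_equiv (Tuple.sort (fun i => -x i)).symm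
      (fun i => by rw [Finset.mem_filter, Finset.mem_filter]; simp [decreasingSort]))

/-- The bids of the bidders in `S`, with all other bids replaced by `0`. -/
def restrictBids {n : ℕ} (S : Finset (Fin n)) (b : Fin n → ℝ) (i : Fin n) : ℝ :=
  if i ∈ S then b i else 0

theorem restrictBids_nonneg {n : ℕ} (S : Finset (Fin n)) {b : Fin n → ℝ} (hb : ∀ i, 0 < b i)
    (i : Fin n) : 0 ≤ restrictBids S b i := by
  unfold restrictBids
  split_ifs
  · exact (hb i).le
  · exact le_rfl

theorem restrictBids_update {n : ℕ} {S : Finset (Fin n)} {i : Fin n} (hi : i ∉ S)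
    (b : Fin n → ℝ) (x : ℝ) : restrictBids S (Function.update b i x) = restrictBids S b := by
  funext j
  unfold restrictBids
  split_ifs with hj
  · rw [Function.update_of_ne (ne_of_mem_of_not_mem hj hi)]
  · rfl

theorem ctr_last (k : ℕ) (α : Fin k → ℝ) : ctr k α (Fin.last k) = 0 := by
  simp [ctr]

theorem ctr_castSucc (k : ℕ) (α : Fin k → ℝ) (j : Fin k) : ctr k α j.castSucc = α j := by
  simp [ctr]

theorem ctr_nonneg {k : ℕ} {α : Fin k → ℝ} (hα : ∀ j, 0 ≤ α j) (j : Fin (k + 1)) :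
    0 ≤ ctr k α j := by
  unfold ctr
  split_ifs
  · exact hα _
  · exact le_rfl

/-- A bidder facing slot prices always has a favourite slot among the affordable ones that are
not in the set `T` of slots already taken; the dummy slot is free and always available. -/
theorem exists_favoriteSlot (k : ℕ) (α P : Fin k → ℝ) (x γ : ℝ) (T : Finset (Fin (k + 1))) :
    ∃ j, (j ∉ T ∨ j = Fin.last k) ∧ ctr k P j ≤ x * ctr k α j ∧
      ∀ j', (j' ∉ T ∨ j' = Fin.last k) → ctr k P j' ≤ x * ctr k α j' →
        x * ctr k α j' - max 0 (ctr k P j' - γ) ≤ x * ctr k α j - max 0 (ctr k P j - γ) := by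
  classical
  obtain ⟨j, hj, hmax⟩ := Finset.exists_max_image
    ({j | (j ∉ T ∨ j = Fin.last k) ∧ ctr k P j ≤ x * ctr k α j} : Finset (Fin (k + 1)))
    (fun j => x * ctr k α j - max 0 (ctr k P j - γ))
    ⟨Fin.last k, by simp [ctr_last]⟩
  simp only [Finset.mem_filter, Finset.mem_univ, true_and] at hj hmax
  exact ⟨j, hj.1, hj.2, fun j' h h' => hmax j' ⟨h, h'⟩⟩

/-- The favourite slot of a bidder with value `x` and allowance `γ` when the slots in `T` are
taken. -/
noncomputable def favoriteSlot (k : ℕ) (α P : Fin k → ℝ) (x γ : ℝ) (T : Finset (Fin (k + 1))) :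
    Fin (k + 1) :=
  (exists_favoriteSlot k α P x γ T).choose

/-- The slots taken by the first `t` bidders, when the bidders outside `S` buy in turn at the
slot prices `P`. -/
noncomputable def takenSlots {n : ℕ} (k : ℕ) (α P : Fin k → ℝ) (S : Finset (Fin n))
    (b g : Fin n → ℝ) : ℕ → Finset (Fin (k + 1))
  | 0 => ∅
  | t + 1 =>
    if h : t < n then
      if ⟨t, h⟩ ∈ S then takenSlots k α P S b g t
      else insert (favoriteSlot k α P (b ⟨t, h⟩) (g ⟨t, h⟩) (takenSlots k α P S b g t))
        (takenSlots k α P S b g t)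
    else takenSlots k α P S b g t

/-- Serial sale: the bidders outside `S`, in index order, take their favourite remaining slots
at the slot prices `P`. -/
noncomputable def serialAssignment {n : ℕ} (k : ℕ) (α P : Fin k → ℝ) (S : Finset (Fin n))
    (b g : Fin n → ℝ) (i : Fin n) : Fin (k + 1) :=
  if i ∈ S then Fin.last k else favoriteSlot k α P (b i) (g i) (takenSlots k α P S b g i)

theorem takenSlots_congr {n k : ℕ} (α P : Fin k → ℝ) (S : Finset (Fin n))
    {b g b' g' : Fin n → ℝ} (t : ℕ)
    (h : ∀ i : Fin n, (i : ℕ) < t → b i = b' i ∧ g i = g' i) :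
    takenSlots k α P S b g t = takenSlots k α P S b' g' t := by
  induction t with
  | zero => rfl
  | succ t ih =>
    have ih' := ih (fun i hi => h i (by omega))
    simp only [takenSlots, ih']
    split_ifs with h1 h2
    · rfl
    · rw [(h ⟨t, h1⟩ (by simp)).1, (h ⟨t, h1⟩ (by simp)).2]
    · rfl

theorem mem_takenSlots {n k : ℕ} (α P : Fin k → ℝ) (S : Finset (Fin n)) (b g : Fin n → ℝ)
    (j : Fin (k + 1)) (t : ℕ) :
    j ∈ takenSlots k α P S b g t ↔
      ∃ i : Fin n, (i : ℕ) < t ∧ i ∉ S ∧ serialAssignment k α P S b g i = j := by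
  induction t with
  | zero => simp [takenSlots]
  | succ t ih =>
    have key : ∀ i : Fin n, (i : ℕ) < t + 1 ↔ (i : ℕ) < t ∨ (i : ℕ) = t := by
      intro i; omega
    simp only [takenSlots]
    split_ifs with h1 h2
    · rw [ih]
      constructor
      · rintro ⟨i, hi, h⟩
        exact ⟨i, by omega, h⟩
      · rintro ⟨i, hi, hS, h⟩
        rcases (key i).1 hi with hi | hi
        · exact ⟨i, hi, hS, h⟩
        · subst hi
          exact absurd h2 hS
    · rw [Finset.mem_insert, ih]
      constructor
      · rintro (h | ⟨i, hi, h⟩)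
        · refine ⟨⟨t, h1⟩, by simp, h2, ?_⟩
          rw [serialAssignment, if_neg h2, h]
        · exact ⟨i, by omega, h⟩
      · rintro ⟨i, hi, hS, h⟩
        rcases (key i).1 hi with hi | hi
        · exact Or.inr ⟨i, hi, hS, h⟩
        · subst hi
          left
          rw [serialAssignment, if_neg hS] at h
          exact h.symm
    · rw [ih]
      constructor
      · rintro ⟨i, hi, h⟩
        exact ⟨i, by omega, h⟩
      · rintro ⟨i, hi, h⟩
        exact ⟨i, by omega, h⟩

theorem serialAssignment_feasible {n k : ℕ} (α P : Fin k → ℝ) (S : Finset (Fin n))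
    (b g : Fin n → ℝ) : Feasible n k (serialAssignment k α P S b g) := by
  have aux : ∀ i j : Fin n, i < j →
      serialAssignment k α P S b g i = serialAssignment k α P S b g j →
      ¬ (serialAssignment k α P S b g j : ℕ) < k := by
    intro i j hij heq hlt
    have hi : i ∉ S := by
      intro hi
      rw [← heq, serialAssignment, if_pos hi] at hlt
      simp at hlt
    have hj : j ∉ S := by
      intro hj
      rw [serialAssignment, if_pos hj] at hlt
      simp at hlt
    have hmem := (mem_takenSlots α P S b g (serialAssignment k α P S b g j) j).2
      ⟨i, hij, hi, heq⟩
    have hspec := (exists_favoriteSlot k α P (b j) (g j)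
      (takenSlots k α P S b g j)).choose_spec.1
    have hdef : serialAssignment k α P S b g j = (exists_favoriteSlot k α P (b j) (g j)
      (takenSlots k α P S b g j)).choose := by
      rw [serialAssignment, if_neg hj, favoriteSlot]
    rw [← hdef] at hspec
    rcases hspec with h | h
    · exact h hmem
    · rw [h] at hlt
      simp at hlt
  intro i j heq hlt
  rcases lt_trichotomy i j with h | h | h
  · exact absurd (heq ▸ hlt) (aux i j h heq)
  · exact h
  · exact absurd hlt (aux j i h heq.symm)

theorem serialAssignment_spec {n k : ℕ} (α P : Fin k → ℝ) {S : Finset (Fin n)}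
    (b g : Fin n → ℝ) {i : Fin n} (hi : i ∉ S) :
    (serialAssignment k α P S b g i ∉ takenSlots k α P S b g i ∨
        serialAssignment k α P S b g i = Fin.last k) ∧
      ∀ j, (j ∉ takenSlots k α P S b g i ∨ j = Fin.last k) → ctr k P j ≤ b i * ctr k α j →
        b i * ctr k α j - max 0 (ctr k P j - g i) ≤
          b i * ctr k α (serialAssignment k α P S b g i) -
            max 0 (ctr k P (serialAssignment k α P S b g i) - g i) := by
  rw [serialAssignment, if_neg hi, favoriteSlot]
  have h := (exists_favoriteSlot k α P (b i) (g i) (takenSlots k α P S b g i)).choose_spec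
  exact ⟨h.1, h.2.2⟩

theorem serialAssignment_affordable {n k : ℕ} (α P : Fin k → ℝ) (S : Finset (Fin n))
    (b g : Fin n → ℝ) (i : Fin n) :
    ctr k P (serialAssignment k α P S b g i) ≤
      b i * ctr k α (serialAssignment k α P S b g i) := by
  unfold serialAssignment
  split_ifs
  · simp [ctr_last]
  · exact (exists_favoriteSlot k α P (b i) (g i) (takenSlots k α P S b g i)).choose_spec.2.1

/-- The serial sale is truthful if the price vector does not depend on the bids of the
buyers. -/
theorem serialSale_truthful {n k : ℕ} (α : Fin k → ℝ) (P : (Fin n → ℝ) → Fin k → ℝ)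
    (S : Finset (Fin n))
    (hP : ∀ i ∉ S, ∀ (b : Fin n → ℝ) (x : ℝ), P (Function.update b i x) = P b) :
    TruthfulPriv n k α (fun b g => serialAssignment k α (P b) S b g)
      (fun b g i => ctr k (P b) (serialAssignment k α (P b) S b g i)) := by
  intro v γ hv hγ i
  refine ⟨serialAssignment_affordable _ _ _ _ _ _, ?_⟩
  intro b' g' hb' hg' hafford
  by_cases hi : i ∈ S
  · simp [serialAssignment, hi, ctr_last]
  · simp only [hP i hi] at hafford ⊢
    refine (serialAssignment_spec α (P v) v γ hi).2 _ ?_ hafford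
    have h := (serialAssignment_spec α (P v) (Function.update v i b')
      (Function.update γ i g') hi).1
    rwa [takenSlots_congr α (P v) S (b' := v) (g' := γ) (i : ℕ)] at h
    intro j hj
    have hne : j ≠ i := fun h => by simp [h] at hj
    simp [Function.update_of_ne hne]

/-- The welfare of a serial sale at half of the benchmark values `θ`: slots for which a
distinct buyer outbids the benchmark contribute. -/
theorem serialSale_welfare {n k : ℕ} {α : Fin k → ℝ} (hα : ∀ j, 0 ≤ α j)
    (θ : Fin k → ℝ) (hθ : ∀ j, 0 ≤ θ j) (S : Finset (Fin n)) (v γ : Fin n → ℝ)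
    (hv : ∀ i, 0 < v i) (hγ : ∀ i, 0 ≤ γ i) (m : Fin k → Fin n) (hm : Function.Injective m)
    (good : Finset (Fin k)) (hgood : ∀ j ∈ good, m j ∉ S ∧ θ j ≤ v (m j)) :
    ∑ j ∈ good, α j * θ j ≤
      4 * welfare n k α v (serialAssignment k α (fun j => α j * θ j / 2) S v γ) := by
  set P : Fin k → ℝ := fun j => α j * θ j / 2 with hPdef
  set π := serialAssignment k α P S v γ with hπ
  set w : Fin n → ℝ := fun i => v i * ctr k α (π i) with hw
  have hw0 : ∀ i, 0 ≤ w i := fun i => mul_nonneg (hv i).le (ctr_nonneg hα _)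
  have hP0 : ∀ j, 0 ≤ P j := fun j => div_nonneg (mul_nonneg (hα j) (hθ j)) (by norm_num)
  have hslot : ∀ j ∈ good,
      α j * θ j / 2 ≤ w (m j) + ∑ i, if π i = j.castSucc then w i else 0 := by
    intro j hj
    obtain ⟨hS, hle⟩ := hgood j hj
    have hmul := mul_le_mul_of_nonneg_left hle (hα j)
    have hsum0 : 0 ≤ ∑ i, if π i = j.castSucc then w i else 0 :=
      Finset.sum_nonneg fun i _ => by split_ifs; exacts [hw0 i, le_rfl]
    by_cases ht : j.castSucc ∈ takenSlots k α P S v γ (m j)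
    · obtain ⟨i, -, -, hi⟩ := (mem_takenSlots α P S v γ j.castSucc (m j)).1 ht
      have h1 : w i ≤ ∑ i, if π i = j.castSucc then w i else 0 := by
        have := Finset.single_le_sum (f := fun i => if π i = j.castSucc then w i else 0)
          (fun i _ => by split_ifs; exacts [hw0 i, le_rfl]) (Finset.mem_univ i)
        rwa [if_pos hi] at this
      have h2 := serialAssignment_affordable α P S v γ i
      rw [hi, ctr_castSucc] at h2
      have h3 : w i = v i * ctr k α j.castSucc := by rw [hw]; dsimp only; rw [hπ, hi]
      have := hw0 (m j)
      have h4 : P j = α j * θ j / 2 := rfl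
      linarith
    · have h1 := (serialAssignment_spec α P v γ hS).2 j.castSucc (Or.inl ht)
      rw [ctr_castSucc, ctr_castSucc] at h1
      have h4 : P j = α j * θ j / 2 := rfl
      have h0 := hP0 j
      have h2 := h1 (by nlinarith)
      have h3 : max 0 (P j - γ (m j)) ≤ P j := max_le h0 (by linarith [hγ (m j)])
      have h5 : w (m j) = v (m j) * ctr k α (serialAssignment k α P S v γ (m j)) := rfl
      have h6 := le_max_left 0 (ctr k P (serialAssignment k α P S v γ (m j)) - γ (m j))
      nlinarith
  have hsum := Finset.sum_le_sum hslot
  rw [Finset.sum_add_distrib, ← Finset.sum_div] at hsum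
  have hA : ∑ j ∈ good, w (m j) ≤ ∑ i, w i := by
    rw [← Finset.sum_image (f := w) (s := good) (g := m) (fun a _ b _ h => hm h)]
    exact Finset.sum_le_sum_of_subset_of_nonneg (Finset.subset_univ _) fun i _ _ => hw0 i
  have hB : ∑ j ∈ good, ∑ i, (if π i = j.castSucc then w i else 0) ≤ ∑ i, w i := by
    rw [Finset.sum_comm]
    refine Finset.sum_le_sum fun i _ => ?_
    by_cases h : ∃ j ∈ good, π i = j.castSucc
    · obtain ⟨j, hj, hij⟩ := h
      rw [Finset.sum_eq_single_of_mem j hj, if_pos hij]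
      intro j' _ hne
      refine if_neg fun h' => hne ?_
      exact Fin.castSucc_injective k (h'.symm.trans hij)
    · push Not at h
      rw [Finset.sum_eq_zero fun j hj => if_neg (h j hj)]
      exact hw0 i
  have : welfare n k α v π = ∑ i, w i := rfl
  linarith

/-- Over all subsets `S`, the squared discrepancies of `A` sum to `#A * 2 ^ n`. -/
theorem sum_sq_discrepancy {ι : Type*} [Fintype ι] [DecidableEq ι] (A : Finset ι) :
    ∑ S : Finset ι, (∑ a ∈ A, if a ∈ S then (1 : ℤ) else -1) ^ 2 =
      #A * 2 ^ Fintype.card ι := by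
  induction A using Finset.induction_on with
  | empty => simp
  | insert a A ha ih =>
    have hcross : ∑ S : Finset ι, (if a ∈ S then (1 : ℤ) else -1) *
        (∑ c ∈ A, if c ∈ S then (1 : ℤ) else -1) = 0 := by
      have hinv : Function.Involutive (fun S : Finset ι => symmDiff S {a}) := fun S => by
        simp
      have h := Equiv.sum_comp (hinv.toPerm _) (fun S : Finset ι => (if a ∈ S then (1 : ℤ) else -1) *
        (∑ c ∈ A, if c ∈ S then (1 : ℤ) else -1))
      have h2 : ∀ S : Finset ι, (fun S : Finset ι => (if a ∈ S then (1 : ℤ) else -1) *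
          (∑ c ∈ A, if c ∈ S then (1 : ℤ) else -1)) ((hinv.toPerm _) S) =
          -((if a ∈ S then (1 : ℤ) else -1) * (∑ c ∈ A, if c ∈ S then (1 : ℤ) else -1)) := by
        intro S
        have hc : ∑ c ∈ A, (if c ∈ symmDiff S {a} then (1 : ℤ) else -1) =
            ∑ c ∈ A, if c ∈ S then (1 : ℤ) else -1 := by
          refine Finset.sum_congr rfl fun c hc => ?_
          have hne : c ≠ a := fun h => ha (h ▸ hc)
          simp [Finset.mem_symmDiff, hne]
        change (if a ∈ symmDiff S {a} then (1 : ℤ) else -1) *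
          (∑ c ∈ A, if c ∈ symmDiff S {a} then (1 : ℤ) else -1) = _
        rw [hc]
        by_cases hS : a ∈ S <;> simp [Finset.mem_symmDiff, hS]
      simp only [h2, Finset.sum_neg_distrib] at h
      omega
    have hexp : ∀ S : Finset ι, (∑ c ∈ insert a A, if c ∈ S then (1 : ℤ) else -1) ^ 2 =
        1 + 2 * ((if a ∈ S then (1 : ℤ) else -1) * (∑ c ∈ A, if c ∈ S then (1 : ℤ) else -1)) +
          (∑ c ∈ A, if c ∈ S then (1 : ℤ) else -1) ^ 2 := by
      intro S
      rw [Finset.sum_insert ha]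
      split_ifs <;> ring
    simp only [hexp, Finset.sum_add_distrib, ← Finset.mul_sum, hcross, ih,
      Finset.card_insert_of_notMem ha]
    simp
    ring

/-- At least three quarters of all subsets `S` split a set `A` of size `4 * r` into two parts of
size at least `r`. -/
theorem card_balanced_subsets {ι : Type*} [Fintype ι] [DecidableEq ι] (A : Finset ι) (r : ℕ)
    (hr : 0 < r) (hA : #A = 4 * r) :
    3 * 2 ^ Fintype.card ι ≤ 4 * #{S : Finset ι | r ≤ #(A ∩ S) ∧ r ≤ #(A \ S)} := by
  have hsq := sum_sq_discrepancy A
  set bad : Finset (Finset ι) := {S : Finset ι | ¬ (r ≤ #(A ∩ S) ∧ r ≤ #(A \ S))} with hbad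
  have hcard := Finset.card_filter_add_card_filter_not (s := (Finset.univ : Finset (Finset ι)))
    (fun S : Finset ι => r ≤ #(A ∩ S) ∧ r ≤ #(A \ S))
  rw [Finset.card_univ, Fintype.card_finset] at hcard
  have h1 : ∑ S ∈ bad, (16 * r : ℤ) ≤
      ∑ S : Finset ι, (∑ a ∈ A, if a ∈ S then (1 : ℤ) else -1) ^ 2 := by
    refine (Finset.sum_le_sum fun S hS => ?_).trans
      (Finset.sum_le_sum_of_subset_of_nonneg (Finset.subset_univ bad) fun S _ _ => sq_nonneg _)
    have hd : ∑ a ∈ A, (if a ∈ S then (1 : ℤ) else -1) = #(A ∩ S) - #(A \ S) := by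
      rw [Finset.sum_ite, Finset.filter_mem_eq_inter, Finset.filter_notMem_eq_sdiff]
      simp
      ring
    rw [hd]
    have hadd := Finset.card_inter_add_card_sdiff A S
    rw [hbad, Finset.mem_filter] at hS
    have hcase : (#(A ∩ S) : ℤ) - #(A \ S) ≤ -(2 * r + 2) ∨
        (2 * r + 2 : ℤ) ≤ #(A ∩ S) - #(A \ S) := by
      omega
    rcases hcase with h | h <;> nlinarith [sq_nonneg ((r : ℤ) - 1)]
  rw [hsq, hA, Finset.sum_const, nsmul_eq_mul] at h1
  push_cast at h1
  have h2 : (4 * #bad : ℤ) ≤ 2 ^ Fintype.card ι := by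
    have hr' : (0 : ℤ) < 4 * r := by positivity
    refine le_of_mul_le_mul_right ?_ hr'
    linarith
  have h3 : 4 * #bad ≤ 2 ^ Fintype.card ι := by exact_mod_cast h2
  rw [hbad] at h3
  linarith

/-- Summing, over all splits, the smaller of the two `j`-th highest values captures the value
of rank `4 * j + 3`. -/
theorem sum_min_decreasingSort_ge {n : ℕ} (v : Fin n → ℝ) (hv : ∀ i, 0 < v i) (j : Fin n)
    (hj : 4 * (j : ℕ) + 3 < n) :
    3 * 2 ^ n * decreasingSort v ⟨4 * j + 3, hj⟩ ≤
      4 * ∑ S : Finset (Fin n), min (decreasingSort (restrictBids S v) j)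
        (decreasingSort (restrictBids Sᶜ v) j) := by
  set y := decreasingSort v ⟨4 * j + 3, hj⟩ with hy
  have hy0 : 0 < y := hv _
  set A : Finset (Fin n) :=
    (Finset.Iic (⟨4 * j + 3, hj⟩ : Fin n)).image (Tuple.sort (fun i => -v i)) with hA
  have hAcard : #A = 4 * ((j : ℕ) + 1) := by
    rw [hA, Finset.card_image_of_injective _ (Equiv.injective _), Fin.card_Iic]
    simp only
    ring
  have hAy : ∀ i ∈ A, y ≤ v i := by
    intro i hi
    obtain ⟨t, ht, rfl⟩ := Finset.mem_image.1 hi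
    exact decreasingSort_antitone v (Finset.mem_Iic.1 ht)
  have hnonneg : ∀ S : Finset (Fin n), 0 ≤ decreasingSort (restrictBids S v) j :=
    fun S => restrictBids_nonneg S hv _
  have hle : ∀ S : Finset (Fin n), (j : ℕ) + 1 ≤ #(A ∩ S) →
      y ≤ decreasingSort (restrictBids S v) j := by
    intro S hS
    have hsub : A ∩ S ⊆ ({i | y ≤ restrictBids S v i} : Finset (Fin n)) := by
      intro i hi
      rw [Finset.mem_inter] at hi
      refine Finset.mem_filter.2 ⟨Finset.mem_univ i, ?_⟩
      rw [restrictBids, if_pos hi.2]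
      exact hAy i hi.1
    exact le_decreasingSort _ _ _ ((Nat.lt_of_succ_le hS).trans_le (Finset.card_le_card hsub))
  have hbal := card_balanced_subsets A ((j : ℕ) + 1) (by omega) hAcard
  rw [Fintype.card_fin] at hbal
  set good : Finset (Finset (Fin n)) :=
    {S | (j : ℕ) + 1 ≤ #(A ∩ S) ∧ (j : ℕ) + 1 ≤ #(A \ S)} with hgood
  have hsum : (#good : ℝ) * y ≤ ∑ S : Finset (Fin n),
      min (decreasingSort (restrictBids S v) j) (decreasingSort (restrictBids Sᶜ v) j) := by
    rw [← nsmul_eq_mul, ← Finset.sum_const]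
    refine (Finset.sum_le_sum fun S hS => ?_).trans
      (Finset.sum_le_sum_of_subset_of_nonneg (Finset.subset_univ good)
        fun S _ _ => le_min (hnonneg _) (hnonneg _))
    rw [hgood, Finset.mem_filter] at hS
    refine le_min (hle S hS.2.1) (hle Sᶜ ?_)
    rw [← Finset.sdiff_eq_inter_compl]
    exact hS.2.2
  have hbal' : (3 * 2 ^ n : ℝ) ≤ 4 * #good := by exact_mod_cast hbal
  nlinarith

/-- The welfare of the sample-price mechanism, summed over all samples. -/
theorem sum_sampleSale_welfare {n k : ℕ} (hkn : k ≤ n) {α : Fin k → ℝ} (hα : ∀ j, 0 ≤ α j)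
    (v γ : Fin n → ℝ) (hv : ∀ i, 0 < v i) (hγ : ∀ i, 0 ≤ γ i) :
    ∑ j : Fin k, α j * ∑ S : Finset (Fin n),
        min (decreasingSort (restrictBids S v) (Fin.castLE hkn j))
          (decreasingSort (restrictBids Sᶜ v) (Fin.castLE hkn j)) ≤
      8 * ∑ S : Finset (Fin n), welfare n k α v (serialAssignment k α
        (fun j => α j * decreasingSort (restrictBids S v) (Fin.castLE hkn j) / 2) S v γ) := by
  set θ : Finset (Fin n) → Fin k → ℝ :=
    fun S j => decreasingSort (restrictBids S v) (Fin.castLE hkn j) with hθ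
  have hθ0 : ∀ S j, 0 ≤ θ S j := fun S j => restrictBids_nonneg S hv _
  have hone : ∀ S : Finset (Fin n), ∑ j, (if θ S j ≤ θ Sᶜ j then α j * θ S j else 0) ≤
      4 * welfare n k α v (serialAssignment k α (fun j => α j * θ S j / 2) S v γ) := by
    intro S
    refine le_trans (le_of_eq ?_) (serialSale_welfare hα (θ S) (hθ0 S) S v γ hv hγ
      (fun j => Tuple.sort (fun i => -restrictBids Sᶜ v i) (Fin.castLE hkn j))
      (fun a b h => by simpa using h) {j | 0 < θ S j ∧ θ S j ≤ θ Sᶜ j} ?_)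
    · rw [Finset.sum_filter]
      refine Finset.sum_congr rfl fun j _ => ?_
      rcases (hθ0 S j).eq_or_lt with h | h
      · simp [← h]
      · simp [h]
    · intro j hj
      rw [Finset.mem_filter] at hj
      have h1 : θ Sᶜ j = restrictBids Sᶜ v
        (Tuple.sort (fun i => -restrictBids Sᶜ v i) (Fin.castLE hkn j)) := rfl
      have h2 := hj.2.1.trans_le hj.2.2
      have h3 := hj.2.2
      rw [h1] at h2 h3
      unfold restrictBids at h2 h3
      split_ifs at h2 h3 with hmem
      · exact ⟨Finset.mem_compl.1 hmem, h3⟩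
      · exact absurd h2 (lt_irrefl _)
  have hpair : ∀ j, ∑ S : Finset (Fin n), min (θ S j) (θ Sᶜ j) ≤
      2 * ∑ S : Finset (Fin n), if θ S j ≤ θ Sᶜ j then θ S j else 0 := by
    intro j
    have hcompl := Equiv.sum_comp (compl_involutive (α := Finset (Fin n))).toPerm
      (fun S : Finset (Fin n) => if θ S j ≤ θ Sᶜ j then θ S j else 0)
    rw [two_mul]
    nth_rewrite 2 [← hcompl]
    rw [← Finset.sum_add_distrib]
    refine Finset.sum_le_sum fun S _ => ?_
    simp only [Function.Involutive.coe_toPerm, compl_compl]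
    have h1 := hθ0 S j
    have h2 := hθ0 Sᶜ j
    rcases le_total (θ S j) (θ Sᶜ j) with h | h
    · rw [min_eq_left h, if_pos h]
      split_ifs <;> linarith
    · rw [min_eq_right h, if_pos h]
      split_ifs <;> linarith
  calc ∑ j : Fin k, α j * ∑ S : Finset (Fin n), min (θ S j) (θ Sᶜ j)
      ≤ ∑ j : Fin k, α j * (2 * ∑ S : Finset (Fin n), if θ S j ≤ θ Sᶜ j then θ S j else 0) :=
        Finset.sum_le_sum fun j _ => mul_le_mul_of_nonneg_left (hpair j) (hα j)
    _ = 2 * ∑ S : Finset (Fin n), ∑ j, (if θ S j ≤ θ Sᶜ j then α j * θ S j else 0) := by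
        rw [Finset.sum_comm, Finset.mul_sum]
        refine Finset.sum_congr rfl fun j _ => ?_
        rw [mul_left_comm, Finset.mul_sum]
        simp only [mul_ite, mul_zero]
    _ ≤ 2 * ∑ S : Finset (Fin n),
          4 * welfare n k α v (serialAssignment k α (fun j => α j * θ S j / 2) S v γ) :=
        mul_le_mul_of_nonneg_left (Finset.sum_le_sum fun S _ => hone S) (by norm_num)
    _ = _ := by
        rw [← Finset.mul_sum]
        ring

/-- The price per click at which bidder `i` wins the top slot in the dyadic auction: the largest
competing bid rounded down to a power of two, doubled for competitors of smaller index. -/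
noncomputable def dyadicThreshold {n : ℕ} (b : Fin n → ℝ) (i : Fin n) : NNReal :=
  (Finset.univ.erase i).sup fun j => 2 ^ (Int.log 2 (b j) + if j < i then 1 else 0)

theorem dyadicThreshold_le_iff {n : ℕ} (b : Fin n → ℝ) (i : Fin n) {x : ℝ} (hx : 0 ≤ x) :
    (dyadicThreshold b i : ℝ) ≤ x ↔
      ∀ j ≠ i, (2 : ℝ) ^ (Int.log 2 (b j) + if j < i then 1 else 0) ≤ x := by
  lift x to NNReal using hx
  rw [NNReal.coe_le_coe, dyadicThreshold, Finset.sup_le_iff]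
  simp only [Finset.mem_erase, Finset.mem_univ, and_true, ← NNReal.coe_le_coe, NNReal.coe_zpow,
    NNReal.coe_ofNat]

theorem dyadicThreshold_update {n : ℕ} (b : Fin n → ℝ) (i : Fin n) (x : ℝ) :
    dyadicThreshold (Function.update b i x) i = dyadicThreshold b i := by
  refine Finset.sup_congr rfl fun j hj => ?_
  rw [Function.update_of_ne (Finset.ne_of_mem_erase hj)]

/-- The dyadic auction sells only the top slot, to the bidder meeting its threshold. -/
noncomputable def dyadicAssignment {n : ℕ} (k : ℕ) (b : Fin n → ℝ) (i : Fin n) :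
    Fin (k + 1) :=
  if (dyadicThreshold b i : ℝ) ≤ b i ∧ 0 < b i then 0 else Fin.last k

/-- The winner of the dyadic auction pays its threshold per click. -/
noncomputable def dyadicPayment {n : ℕ} (k : ℕ) (α : Fin k → ℝ) (b : Fin n → ℝ)
    (i : Fin n) : ℝ :=
  dyadicThreshold b i * ctr k α (dyadicAssignment k b i)

theorem dyadicAssignment_feasible {n k : ℕ} (b : Fin n → ℝ) :
    Feasible n k (dyadicAssignment k b) := by
  have hwin : ∀ i : Fin n, (dyadicAssignment k b i : ℕ) < k →
      (dyadicThreshold b i : ℝ) ≤ b i ∧ 0 < b i := by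
    intro i hi
    by_contra h
    rw [dyadicAssignment, if_neg h] at hi
    simp at hi
  have hlog : ∀ i j : Fin n, i ≠ j → (dyadicAssignment k b i : ℕ) < k →
      Int.log 2 (b j) + (if j < i then 1 else 0) ≤ Int.log 2 (b i) := by
    intro i j hij hi
    obtain ⟨h1, h2⟩ := hwin i hi
    have := (dyadicThreshold_le_iff b i h2.le).1 h1 j hij.symm
    exact (Int.zpow_le_iff_le_log (by norm_num) h2).1 (by exact_mod_cast this)
  intro i j heq hi
  by_contra hij
  have h1 := hlog i j hij hi
  have h2 := hlog j i (Ne.symm hij) (heq ▸ hi)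
  rcases lt_or_gt_of_ne hij with h | h
  · rw [if_neg h.not_gt] at h1
    rw [if_pos h] at h2
    omega
  · rw [if_neg h.not_gt] at h2
    rw [if_pos h] at h1
    omega

theorem dyadicAuction_truthful {n k : ℕ} {α : Fin k → ℝ} (hα : ∀ j, 0 ≤ α j) :
    TruthfulPriv n k α (fun b _ => dyadicAssignment k b) (fun b _ => dyadicPayment k α b) := by
  intro v γ hv hγ i
  have hc := ctr_nonneg hα (0 : Fin (k + 1))
  have hτ : (0 : ℝ) ≤ dyadicThreshold v i := NNReal.coe_nonneg _
  have hmax : ∀ {x : ℝ}, x ≤ v i * ctr k α 0 → max 0 (x - γ i) ≤ v i * ctr k α 0 := by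
    intro x hx
    exact max_le (mul_nonneg (hv i).le hc) (by linarith [hγ i])
  have hzero : max 0 (-γ i) = 0 := max_eq_left (by linarith [hγ i])
  constructor
  · simp only [dyadicPayment]
    by_cases h : (dyadicThreshold v i : ℝ) ≤ v i
    · exact mul_le_mul_of_nonneg_right h (ctr_nonneg hα _)
    · simp [dyadicAssignment, h, ctr_last]
  · intro b' g' hb' _ hafford
    simp only [dyadicPayment, dyadicAssignment, dyadicThreshold_update, Function.update_self,
      hb', hv i, and_true] at hafford ⊢
    by_cases h : (dyadicThreshold v i : ℝ) ≤ v i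
    · have h1 := hmax (mul_le_mul_of_nonneg_right h hc)
      split_ifs
      · exact le_rfl
      · simp only [ctr_last, mul_zero, zero_sub, hzero]
        linarith
    · by_cases h' : (dyadicThreshold v i : ℝ) ≤ b'
      · simp only [h, h', if_true, if_false] at hafford ⊢
        have hc0 : ctr k α 0 = 0 := by
          push Not at h
          nlinarith
        simp [ctr_last, hc0]
      · simp [h, h']

theorem dyadicAuction_welfare {n k : ℕ} {α : Fin k → ℝ} (hα : ∀ j, 0 ≤ α j)
    (v : Fin n → ℝ) (hv : ∀ i, 0 < v i) (t : Fin n) :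
    ctr k α 0 * v t ≤ 2 * welfare n k α v (dyadicAssignment k v) := by
  obtain ⟨m, -, hm⟩ := Finset.exists_max_image Finset.univ (fun i => Int.log 2 (v i))
    ⟨t, Finset.mem_univ t⟩
  set A : Finset (Fin n) := {i | Int.log 2 (v i) = Int.log 2 (v m)} with hA
  have hAne : A.Nonempty := ⟨m, by simp [hA]⟩
  set i := A.min' hAne with hi
  have hiA : Int.log 2 (v i) = Int.log 2 (v m) := by
    have := A.min'_mem hAne
    rw [← hi, hA, Finset.mem_filter] at this
    exact this.2
  have hwin : (dyadicThreshold v i : ℝ) ≤ v i := by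
    rw [dyadicThreshold_le_iff v i (hv i).le]
    intro j hj
    refine le_trans ?_ (Int.zpow_log_le_self (b := 2) (by norm_num) (hv i))
    rw [Nat.cast_ofNat]
    refine zpow_le_zpow_right₀ (by norm_num) ?_
    have hjm := hm j (Finset.mem_univ j)
    split_ifs with hlt
    · have hne : Int.log 2 (v j) ≠ Int.log 2 (v m) := fun h =>
        absurd (A.min'_le j (by simp [hA, h])) (not_le.2 hlt)
      omega
    · omega
  have hvt : v t ≤ 2 * v i := by
    have h1 := Int.lt_zpow_succ_log_self (b := 2) (by norm_num) (v t)
    have h2 := Int.zpow_log_le_self (b := 2) (by norm_num) (hv i)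
    have h3 : ((2 : ℕ) : ℝ) ^ (Int.log 2 (v t) + 1) ≤ ((2 : ℕ) : ℝ) ^ (Int.log 2 (v i) + 1) :=
      zpow_le_zpow_right₀ (by norm_num) (by
        have := hm t (Finset.mem_univ t)
        omega)
    rw [zpow_add_one₀ (by norm_num) (Int.log 2 (v i))] at h3
    push_cast at h1 h2 h3
    linarith
  have hw : v i * ctr k α 0 ≤ welfare n k α v (dyadicAssignment k v) := by
    have := Finset.single_le_sum (f := fun i => v i * ctr k α (dyadicAssignment k v i))
      (fun i _ => mul_nonneg (hv i).le (ctr_nonneg hα _)) (Finset.mem_univ i)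
    simpa [dyadicAssignment, hwin, hv i, welfare] using this
  nlinarith [ctr_nonneg hα (0 : Fin (k + 1))]

/-- Extension of a finite sequence by zeros. -/
def zeroExtend {n : ℕ} (x : Fin n → ℝ) (t : ℕ) : ℝ := if h : t < n then x ⟨t, h⟩ else 0

theorem zeroExtend_nonneg {n : ℕ} {x : Fin n → ℝ} (hx : ∀ i, 0 ≤ x i) (t : ℕ) :
    0 ≤ zeroExtend x t := by
  unfold zeroExtend
  split_ifs
  · exact hx _
  · exact le_rfl

theorem zeroExtend_antitone {n : ℕ} {x : Fin n → ℝ} (hx : ∀ i, 0 ≤ x i) (h : Antitone x) :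
    Antitone (zeroExtend x) := by
  intro s t hst
  by_cases ht : t < n
  · have hs : s < n := hst.trans_lt ht
    simp only [zeroExtend, ht, hs, dif_pos]
    exact h hst
  · rw [zeroExtend, dif_neg ht]
    exact zeroExtend_nonneg hx s

theorem ctr_eq_zeroExtend (k : ℕ) (α : Fin k → ℝ) (j : Fin (k + 1)) :
    ctr k α j = zeroExtend α j := rfl

/-- The welfare of a feasible assignment is at most that of the sorted assignment. -/
theorem welfare_le_sorted {n k : ℕ} (hkn : k ≤ n) {α : Fin k → ℝ} (hα : ∀ j, 0 ≤ α j)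
    (hmono : Antitone α) (v : Fin n → ℝ) (hv : ∀ i, 0 < v i)
    (π : Fin n → Fin (k + 1)) (hπ : Feasible n k π) :
    welfare n k α v π ≤ ∑ t ∈ Finset.range n,
      zeroExtend α t * zeroExtend (decreasingSort v) t := by
  obtain ⟨σ, hσ⟩ : ∃ σ : Equiv.Perm (Fin n), ∀ i, (π i : ℕ) < k → (σ i : ℕ) = π i := by
    rcases Nat.eq_zero_or_pos n with rfl | hn
    · exact ⟨1, fun i => i.elim0⟩
    set f : Fin n → Fin n := fun i => if h : (π i : ℕ) < k then ⟨π i, h.trans_le hkn⟩ else ⟨0, hn⟩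
    have hinj : Set.InjOn f {i | (π i : ℕ) < k} := by
      intro i hi j hj hij
      simp only [Set.mem_ofPred_eq] at hi hj
      simp only [f, hi, hj, dif_pos, Fin.mk.injEq] at hij
      exact hπ i j (Fin.ext hij) hi
    obtain ⟨g, hg⟩ := Set.MapsTo.exists_equiv_extend_of_card_eq (t := Finset.univ)
      (s := {i | (π i : ℕ) < k}) (f := f) (by simp) (fun i _ => by simp) hinj
    refine ⟨g.trans (Equiv.subtypeUnivEquiv Finset.mem_univ), fun i hi => ?_⟩
    have := hg i hi
    simp [this, f, hi]
  set e := Tuple.sort (fun i => -v i) with he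
  have h1 : welfare n k α v π ≤ ∑ i, v i * zeroExtend α (σ i) := by
    refine Finset.sum_le_sum fun i _ => mul_le_mul_of_nonneg_left ?_ (hv i).le
    by_cases hi : (π i : ℕ) < k
    · rw [ctr_eq_zeroExtend, hσ i hi]
    · rw [ctr, dif_neg hi]
      exact zeroExtend_nonneg hα _
  have hmv : Monovary (decreasingSort v) (fun t : Fin n => zeroExtend α t) :=
    Antitone.monovary (decreasingSort_antitone v)
      (fun s t hst => zeroExtend_antitone hα hmono hst)
  have h2 := hmv.sum_mul_comp_perm_le_sum_mul (σ := e.trans σ)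
  rw [← Equiv.sum_comp e] at h1
  refine h1.trans (h2.trans (le_of_eq ?_))
  rw [Finset.sum_range]
  refine Finset.sum_congr rfl fun t _ => ?_
  simp [zeroExtend, mul_comm]

/-- Grouping the terms of a sum of products of decreasing sequences in blocks of four. -/
theorem sum_range_mul_le (a y : ℕ → ℝ) (ha : Antitone a) (hy : Antitone y)
    (ha0 : ∀ t, 0 ≤ a t) (hy0 : ∀ t, 0 ≤ y t) (m : ℕ) :
    ∑ t ∈ Finset.range m, a t * y t ≤
      3 * (a 0 * y 0) + 4 * ∑ r ∈ Finset.range m, a r * y (4 * r + 3) := by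
  have hmul : ∀ {s t : ℕ}, s ≤ t → a t * y t ≤ a s * y s := fun h =>
    mul_le_mul (ha h) (hy h) (hy0 _) (ha0 _)
  have hlong : ∑ t ∈ Finset.range (4 * m + 3), a t * y t ≤
      3 * (a 0 * y 0) + 4 * ∑ r ∈ Finset.range m, a r * y (4 * r + 3) := by
    induction m with
    | zero =>
      simp only [Nat.mul_zero, Nat.zero_add, Finset.sum_range_succ, Finset.range_zero,
        Finset.sum_empty]
      linarith [hmul (Nat.zero_le 1), hmul (Nat.zero_le 2)]
    | succ m ih =>
      have hm : 4 * (m + 1) + 3 = 4 * m + 3 + 1 + 1 + 1 + 1 := by ring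
      rw [hm, Finset.sum_range_succ, Finset.sum_range_succ, Finset.sum_range_succ,
        Finset.sum_range_succ, Finset.sum_range_succ _ m]
      have h0 : a (4 * m + 3) * y (4 * m + 3) ≤ a m * y (4 * m + 3) :=
        mul_le_mul_of_nonneg_right (ha (by omega)) (hy0 _)
      have h1 := hmul (show 4 * m + 3 ≤ 4 * m + 3 + 1 by omega)
      have h2 := hmul (show 4 * m + 3 ≤ 4 * m + 3 + 1 + 1 by omega)
      have h3 := hmul (show 4 * m + 3 ≤ 4 * m + 3 + 1 + 1 + 1 by omega)
      linarith
  refine le_trans (Finset.sum_le_sum_of_subset_of_nonneg ?_ fun t _ _ =>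
    mul_nonneg (ha0 t) (hy0 t)) hlong
  exact Finset.range_mono (by omega)

/-- The optimum is bounded by the two mechanisms' benchmarks. -/
theorem OPT_le {n k : ℕ} (hkn : k ≤ n) {α : Fin k → ℝ} (hα : ∀ j, 0 ≤ α j)
    (hmono : Antitone α) (v : Fin n → ℝ) (hv : ∀ i, 0 < v i) :
    OPT n k α v ≤ 3 * (zeroExtend α 0 * zeroExtend (decreasingSort v) 0) +
      4 * ∑ j : Fin k, α j * zeroExtend (decreasingSort v) (4 * j + 3) := by
  have hy0 : ∀ i, 0 ≤ decreasingSort v i := fun i => (hv _).le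
  refine csSup_le ⟨_, fun _ => Fin.last k, ?_, rfl⟩ ?_
  · intro i j _ h
    simp at h
  · rintro w ⟨π, hπ, rfl⟩
    refine (welfare_le_sorted hkn hα hmono v hv π hπ).trans ((sum_range_mul_le _ _
      (zeroExtend_antitone hα hmono) (zeroExtend_antitone hy0 (decreasingSort_antitone v))
      (zeroExtend_nonneg hα) (zeroExtend_nonneg hy0) n).trans (le_of_eq ?_))
    congr 2
    rw [← Finset.sum_subset (Finset.range_mono hkn), Finset.sum_range]
    · refine Finset.sum_congr rfl fun j _ => ?_
      simp [zeroExtend]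
    · intro t _ ht
      rw [Finset.mem_range] at ht
      simp [zeroExtend, ht]

/-- Theorem 2: in the private allowance setting there is a universally truthful randomized
mechanism (a finite probability space with a deterministic truthful mechanism per outcome)
whose expected welfare at the truthful report is at least
`OPT / ((49 + 8√3) (1 + ε))` for every true profile. -/
theorem private_allowance_constant (ε : ℝ) (hε₀ : 0 < ε) (hε₁ : ε < 1)
    (n k : ℕ) (hk : 1 ≤ k) (hkn : k ≤ n) (hn : 2 ≤ n)
    (α : Fin k → ℝ) (hα : ∀ j, 0 ≤ α j)
    (hmono : ∀ j j' : Fin k, j ≤ j' → α j' ≤ α j) :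
    ∃ (m : ℕ) (μ : Fin m → ℝ)
      (asg : Fin m → (Fin n → ℝ) → (Fin n → ℝ) → Fin n → Fin (k + 1))
      (pay : Fin m → (Fin n → ℝ) → (Fin n → ℝ) → Fin n → ℝ),
      (∀ ω, 0 ≤ μ ω) ∧ (∑ ω, μ ω) = 1 ∧
      (∀ ω b g, Feasible n k (asg ω b g)) ∧
      (∀ ω, TruthfulPriv n k α (asg ω) (pay ω)) ∧
      ∀ v γ : Fin n → ℝ, (∀ i, 0 < v i) → (∀ i, 0 ≤ γ i) →
        (∑ ω, μ ω * welfare n k α v (asg ω v γ)) ≥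
          OPT n k α v / ((49 + 8 * Real.sqrt 3) * (1 + ε)) := by
  set q : Finset (Fin n) → (Fin n → ℝ) → Fin k → ℝ := fun S b j =>
    α j * decreasingSort (restrictBids S b) (Fin.castLE hkn j) / 2 with hq
  let asg : Option (Finset (Fin n)) → (Fin n → ℝ) → (Fin n → ℝ) → Fin n → Fin (k + 1) :=
    fun o => o.elim (fun b _ => dyadicAssignment k b)
      (fun S b g => serialAssignment k α (q S b) S b g)
  let pay : Option (Finset (Fin n)) → (Fin n → ℝ) → (Fin n → ℝ) → Fin n → ℝ :=
    fun o => o.elim (fun b _ => dyadicPayment k α b)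
      (fun S b g i => ctr k (q S b) (serialAssignment k α (q S b) S b g i))
  let μ : Option (Finset (Fin n)) → ℝ := fun o => o.elim (1 / 8) (fun _ => 7 / 8 / 2 ^ n)
  let e := (Fintype.equivFin (Option (Finset (Fin n)))).symm
  refine ⟨_, μ ∘ e, fun ω => asg (e ω), fun ω => pay (e ω), ?_, ?_, ?_, ?_, ?_⟩
  · intro ω
    simp only [Function.comp_apply]
    cases e ω <;> simp only [μ, Option.elim] <;> positivity
  · simp only [Function.comp_apply]
    rw [Equiv.sum_comp e μ, Fintype.sum_option]
    simp only [μ, Option.elim, Finset.sum_const, Finset.card_univ, Fintype.card_finset,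
      Fintype.card_fin, nsmul_eq_mul]
    push_cast
    field_simp
    norm_num
  · intro ω b g
    change Feasible n k (asg (e ω) b g)
    cases e ω with
    | none => exact dyadicAssignment_feasible b
    | some S => exact serialAssignment_feasible α (q S b) S b g
  · intro ω
    change TruthfulPriv n k α (asg (e ω)) (pay (e ω))
    cases e ω with
    | none => exact dyadicAuction_truthful hα
    | some S =>
      refine serialSale_truthful α (q S) S ?_
      intro i hi b x
      simp only [hq, restrictBids_update hi]
  · intro v γ hv hγ
    have hmono' : Antitone α := fun j j' h => hmono j j' h
    simp only [Function.comp_apply]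
    rw [Equiv.sum_comp e (fun o => μ o * welfare n k α v (asg o v γ)), Fintype.sum_option]
    simp only [μ, asg, Option.elim, ← Finset.mul_sum]
    have hpow : (0 : ℝ) < 2 ^ n := by positivity
    have hOPT := OPT_le hkn hα hmono' v hv
    have hOPT0 : 0 ≤ OPT n k α v := by
      refine Real.sSup_nonneg ?_
      rintro w ⟨π, -, rfl⟩
      exact Finset.sum_nonneg fun i _ => mul_nonneg (hv i).le (ctr_nonneg hα _)
    have hV : zeroExtend α 0 * zeroExtend (decreasingSort v) 0 ≤
        2 * welfare n k α v (dyadicAssignment k v) := by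
      have h := dyadicAuction_welfare hα v hv (Tuple.sort (fun i => -v i) ⟨0, by omega⟩)
      have h0 : zeroExtend (decreasingSort v) 0 =
        v (Tuple.sort (fun i => -v i) ⟨0, by omega⟩) := dif_pos (by omega)
      rw [h0]
      exact h
    have hZ : 3 * 2 ^ n * ∑ j : Fin k, α j * zeroExtend (decreasingSort v) (4 * j + 3) ≤
        32 * ∑ S : Finset (Fin n), welfare n k α v (serialAssignment k α (q S v) S v γ) := by
      have h := sum_sampleSale_welfare hkn hα v γ hv hγ
      have h2 : 3 * 2 ^ n * ∑ j : Fin k, α j * zeroExtend (decreasingSort v) (4 * j + 3) ≤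
          4 * ∑ j : Fin k, α j * ∑ S : Finset (Fin n),
            min (decreasingSort (restrictBids S v) (Fin.castLE hkn j))
              (decreasingSort (restrictBids Sᶜ v) (Fin.castLE hkn j)) := by
        rw [Finset.mul_sum, Finset.mul_sum]
        refine Finset.sum_le_sum fun j _ => ?_
        rw [mul_left_comm, mul_left_comm 4]
        refine mul_le_mul_of_nonneg_left ?_ (hα j)
        unfold zeroExtend
        split_ifs with hj
        · exact sum_min_decreasingSort_ge v hv (Fin.castLE hkn j) hj
        · rw [mul_zero]
          exact mul_nonneg (by norm_num) (Finset.sum_nonneg fun S _ =>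
            le_min (restrictBids_nonneg S hv _) (restrictBids_nonneg Sᶜ hv _))
      linarith
    have hden : (49 : ℝ) ≤ (49 + 8 * Real.sqrt 3) * (1 + ε) := by
      have := Real.sqrt_nonneg 3
      nlinarith
    have hbound : OPT n k α v / ((49 + 8 * Real.sqrt 3) * (1 + ε)) ≤ OPT n k α v / 49 :=
      div_le_div_of_nonneg_left hOPT0 (by norm_num) hden
    set Z := ∑ j : Fin k, α j * zeroExtend (decreasingSort v) (4 * j + 3) with hZdef
    set W := ∑ S : Finset (Fin n), welfare n k α v (serialAssignment k α (q S v) S v γ)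
    have hZ' : 3 * Z ≤ 32 * (W / 2 ^ n) := by
      rw [← mul_div_assoc, le_div_iff₀ hpow]
      linarith
    have hV0 : 0 ≤ zeroExtend α 0 * zeroExtend (decreasingSort v) 0 :=
      mul_nonneg (zeroExtend_nonneg hα _) (zeroExtend_nonneg (fun i => (hv _).le) _)
    have hZ0 : 0 ≤ Z := Finset.sum_nonneg fun j _ =>
      mul_nonneg (hα j) (zeroExtend_nonneg (fun i => (hv _).le) _)
    have hsplit : 7 / 8 / 2 ^ n * W = 7 / 8 * (W / 2 ^ n) := by ring
    rw [hsplit]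
    linarith
end

section
/- If the pair (x, p) is truthful for allowance γ, then the allocation rule x is nondecreasing on (0,∞): for all values 0 < v̂ < v one has x(v̂) ≤ x(v). (Allocation monotonicity part of Lemma 1.) -/
/-- A single-bidder allocation/payment pair `(x, p)` (CTR obtained and payment as functions
of the bid, with the other bids fixed) is truthful for allowance `γ`: for every private
value `v > 0`, individual rationality holds at the truthful bid, and no feasible misreport
improves the allowance utility `v·x − max 0 (p − γ)`. -/
def TruthfulPair (γ : ℝ) (x p : ℝ → ℝ) : Prop :=
  ∀ v : ℝ, 0 < v →
    p v ≤ v * x v ∧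
    ∀ b : ℝ, 0 < b → p b ≤ v * x b →
      v * x v - max 0 (p v - γ) ≥ v * x b - max 0 (p b - γ)

/-- Allocation monotonicity part of Lemma 1: a truthful pair has a nondecreasing
allocation rule on `(0, ∞)`. -/
theorem allocation_monotonicity (γ : ℝ) (hγ : 0 ≤ γ) (x p : ℝ → ℝ)
    (hx : ∀ v : ℝ, 0 < v → 0 ≤ x v) (h : TruthfulPair γ x p)
    (vhat v : ℝ) (hvhat : 0 < vhat) (hlt : vhat < v) : x vhat ≤ x v := by
  by_contra! hdec
  have hpos : 0 < (v - vhat) * (x vhat - x v) := mul_pos (by linarith) (by linarith)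
  have hvpos : 0 < v * (x vhat - x v) := mul_pos (by linarith) (by linarith)
  obtain ⟨-, hICv⟩ := h v (by linarith)
  obtain ⟨hIR, hIC⟩ := h vhat hvhat
  have hmul : vhat * x vhat ≤ v * x vhat := mul_le_mul_of_nonneg_right hlt.le (hx vhat hvhat)
  have hdev := hICv vhat hvhat (hIR.trans hmul)
  rcases le_or_gt (p v) (vhat * x v) with hfeas | hinfeas
  · have hback := hIC v (by linarith) hfeas
    linarith
  · have hcharge : 0 < p vhat - γ := by
      by_contra! hle
      rw [max_eq_left hle] at hdev
      linarith [le_max_left 0 (p v - γ)]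
    rw [max_eq_right hcharge.le] at hdev
    linarith [le_max_right 0 (p v - γ)]
end

section
/- If the pair (x, p) is truthful for allowance γ, then the paid unit price is strictly monotone across the allowance threshold: for all 0 < v < v', if x(v') > γ/v, γ/v > x(v), and x(v) > 0, then p(v') > v·x(v'). (Unit-price strict-monotonicity part of Lemma 1.) -/
/-- Unit-price strict-monotonicity part of Lemma 1: if a truthful pair allocates across
the allowance threshold, the paid unit price must strictly exceed the lower value. -/
theorem unit_price_strict_monotonicity (γ : ℝ) (hγ : 0 ≤ γ) (x p : ℝ → ℝ)
    (hx : ∀ v : ℝ, 0 < v → 0 ≤ x v) (h : TruthfulPair γ x p)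
    (v v' : ℝ) (hv : 0 < v) (hlt : v < v')
    (h1 : x v' > γ / v) (h2 : γ / v > x v) (h3 : 0 < x v) :
    p v' > v * x v' := by
  by_contra! hp
  obtain ⟨hir, hic⟩ := h v hv
  have hx' : γ < x v' * v := (div_lt_iff₀ hv).mp h1
  have hxv : x v * v < γ := (lt_div_iff₀ hv).mp h2
  have hdev := hic v' (hv.trans hlt) hp
  rw [max_eq_left (by linarith : p v - γ ≤ 0)] at hdev
  rcases max_cases 0 (p v' - γ) with ⟨hm, -⟩ | ⟨hm, -⟩ <;> rw [hm] at hdev <;> linarith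
end

section
/- Let ℓ ≥ 1, let w₁, …, w_ℓ be positive reals with sum W, and let ρ ≥ 1 satisfy w_i < W/ρ for every i. If each index is placed independently and uniformly at random into one of two sets A and B, then with probability at least 1/2 there exist a subset S ⊆ A and an injection f : S → B such that Σ_{i ∈ S} min(w_i, w_{f(i)}) > (W/3)·(1 − 1/ρ). (Lemma 3.) -/
open Finset

/-- A function `h` (thought of as `x ↦ P(Y < x)`) is *tame* if `2 h s + h p + h q ≤ 2` whenever
`s` is the least of three numbers with nonpositive sum. In particular `h 0 ≤ 1 / 2`. -/
def IsTame (h : ℝ → ℝ) : Prop :=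
  ∀ s p q : ℝ, s ≤ p → s ≤ q → s + p + q ≤ 0 → 2 * h s + h p + h q ≤ 2

/-- The effect on a distribution function of adding an independent variable which is
`2 * a - b`, `2 * b - a`, `-a - b` with probabilities `1 / 2`, `1 / 4`, `1 / 4`. -/
noncomputable def pairStep (a b : ℝ) (h : ℝ → ℝ) (x : ℝ) : ℝ :=
  (2 * h (x - 2 * a + b) + h (x + a - 2 * b) + h (x + a + b)) / 4

theorem IsTame.pairStep {h : ℝ → ℝ} (hh : IsTame h) {a b : ℝ} (hb : 0 ≤ b) (hab : b ≤ a) :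
    IsTame (pairStep a b h) := by
  have key : ∀ s p q : ℝ, s ≤ p → p ≤ q → s + p + q ≤ 0 →
      2 * _root_.pairStep a b h s + _root_.pairStep a b h p + _root_.pairStep a b h q ≤ 2 := by
    intro s p q hsp hpq hsum
    unfold _root_.pairStep
    have h1 := hh (s - 2 * a + b) (p + a - 2 * b) (q + a + b)
      (by linarith) (by linarith) (by linarith)
    have h2 := hh (s - 2 * a + b) (p + a + b) (q + a - 2 * b)
      (by linarith) (by linarith) (by linarith)
    rcases le_total (s + 3 * a) p with hp | hp
    · have h3 := hh (s + a - 2 * b) (p - 2 * a + b) (q - 2 * a + b)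
        (by linarith) (by linarith) (by linarith)
      have h4 := hh (s + a + b) (p - 2 * a + b) (q - 2 * a + b)
        (by linarith) (by linarith) (by linarith)
      linarith
    · rcases le_total (s + 3 * a - 3 * b) q with hq | hq
      · have h3 := hh (p - 2 * a + b) (s + a + b) (q - 2 * a + b)
          (by linarith) (by linarith) (by linarith)
        have h4 := hh (s + a - 2 * b) (s + a + b) (q - 2 * a + b)
          (by linarith) (by linarith) (by linarith)
        linarith
      · have h3 := hh (p - 2 * a + b) (s + a - 2 * b) (s + a + b)
          (by linarith) (by linarith) (by linarith)
        have h4 := hh (q - 2 * a + b) (s + a - 2 * b) (s + a + b)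
          (by linarith) (by linarith) (by linarith)
        linarith
  intro s p q hsp hsq hsum
  rcases le_total p q with hpq | hpq
  · exact key s p q hsp hpq hsum
  · linarith [key s q p hsq hpq (by linarith)]

/-- The distribution function `x ↦ P(Y < x)` of the score of the greedy matching on a list of
weights. -/
noncomputable def scoreDist : List ℝ → ℝ → ℝ
  | [] => fun x => if 0 < x then 1 else 0
  | [a] => pairStep a 0 (scoreDist [])
  | a :: b :: l => pairStep a b (scoreDist l)

theorem isTame_scoreDist : ∀ l : List ℝ, (∀ x ∈ l, 0 ≤ x) → l.Pairwise (· ≥ ·) →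
    IsTame (scoreDist l)
  | [], _, _ => by
    intro s p q hsp hsq hsum
    have hs : ¬ 0 < s := by linarith
    simp only [scoreDist, if_neg hs]
    split_ifs <;> norm_num
  | [a], h0, _ => by
    have ha : 0 ≤ a := h0 a (by simp)
    rw [scoreDist]
    exact (isTame_scoreDist [] (by simp) List.Pairwise.nil).pairStep le_rfl ha
  | a :: b :: l, h0, hl => by
    rw [scoreDist]
    rw [List.pairwise_cons, List.pairwise_cons] at hl
    exact (isTame_scoreDist l (fun x hx => h0 x (by simp [hx])) hl.2.2).pairStep
      (h0 b (by simp)) (hl.1 b (by simp))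

section Greedy

variable {ι : Type*}

/-- Three times the weight of the greedy matching minus the total weight. The indices of the list
are read two at a time, while one earlier element on side `c` is waiting for a partner. -/
def greedyScore (w : ι → ℝ) (σ : ι → Bool) : Bool → List ι → ℝ
  | _, [] => 0
  | c, [a] => if σ a ≠ c then 2 * w a else -w a
  | c, a :: b :: l =>
    if σ a ≠ c then 2 * w a - w b + greedyScore w σ (σ b) l
    else if σ b ≠ c then 2 * w b - w a + greedyScore w σ c l
    else -w a - w b + greedyScore w σ c l

theorem greedyScore_congr (w : ι → ℝ) {σ τ : ι → Bool} : ∀ (c : Bool) (l : List ι),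
    (∀ i ∈ l, σ i = τ i) → greedyScore w σ c l = greedyScore w τ c l
  | _, [], _ => rfl
  | c, [a], h => by simp only [greedyScore, h a (by simp)]
  | c, a :: b :: l, h => by
    have hl : ∀ i ∈ l, σ i = τ i := fun i hi => h i (by simp [hi])
    simp only [greedyScore, h a (by simp), h b (by simp), greedyScore_congr w _ l hl]

/-- Within the indices satisfying `D`, there is a matching between the two sides of weight at
least `m`. -/
def HasMatching (w : ι → ℝ) (σ : ι → Bool) (D : ι → Prop) (m : ℝ) : Prop :=
  ∃ (S : Finset ι) (f : ι → ι), (∀ i ∈ S, σ i = true ∧ D i) ∧ Set.InjOn f S ∧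
    (∀ i ∈ S, σ (f i) = false ∧ D (f i)) ∧ m ≤ ∑ i ∈ S, min (w i) (w (f i))

theorem HasMatching.mono {w : ι → ℝ} {σ : ι → Bool} {D E : ι → Prop} {m n : ℝ}
    (h : HasMatching w σ D m) (hDE : ∀ i, D i → E i) (hmn : n ≤ m) : HasMatching w σ E n := by
  obtain ⟨S, f, h1, h2, h3, h4⟩ := h
  exact ⟨S, f, fun i hi => ⟨(h1 i hi).1, hDE _ (h1 i hi).2⟩, h2,
    fun i hi => ⟨(h3 i hi).1, hDE _ (h3 i hi).2⟩, hmn.trans h4⟩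

theorem hasMatching_zero (w : ι → ℝ) (σ : ι → Bool) (D : ι → Prop) : HasMatching w σ D 0 :=
  ⟨∅, id, by simp, by simp, by simp, by simp⟩

variable [DecidableEq ι]

theorem HasMatching.insert {w : ι → ℝ} {σ : ι → Bool} {D : ι → Prop} {m : ℝ}
    (h : HasMatching w σ D m) {i j : ι} (hi : ¬ D i) (hj : ¬ D j) (hij : σ i ≠ σ j) :
    HasMatching w σ (fun k => k = i ∨ k = j ∨ D k) (m + min (w i) (w j)) := by
  wlog hσ : σ i = true generalizing i j
  · have hσj : σ j = true := by
      cases h1 : σ i <;> cases h2 : σ j <;> simp_all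
    rw [min_comm]
    exact (this hj hi hij.symm hσj).mono (fun k hk => by tauto) le_rfl
  have hσj : σ j = false := by
    cases h2 : σ j <;> simp_all
  obtain ⟨S, f, h1, h2, h3, h4⟩ := h
  have hiS : i ∉ S := fun hS => hi (h1 i hS).2
  have hne : ∀ k ∈ S, k ≠ i := fun k hk hki => hiS (hki ▸ hk)
  have hf : ∀ k ∈ S, Function.update f i j k = f k := fun k hk =>
    Function.update_of_ne (hne k hk) _ _
  refine ⟨Insert.insert i S, Function.update f i j, ?_, ?_, ?_, ?_⟩
  · intro k hk
    rcases Finset.mem_insert.1 hk with rfl | hk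
    · exact ⟨hσ, Or.inl rfl⟩
    · exact ⟨(h1 k hk).1, Or.inr (Or.inr (h1 k hk).2)⟩
  · rw [Finset.coe_insert, Set.injOn_insert (by simpa using hiS)]
    refine ⟨fun x hx y hy hxy => ?_, ?_⟩
    · rw [hf x hx, hf y hy] at hxy
      exact h2 hx hy hxy
    · rintro ⟨k, hk, hkj⟩
      rw [hf k hk, Function.update_self] at hkj
      exact hj (hkj ▸ (h3 k hk).2)
  · intro k hk
    rcases Finset.mem_insert.1 hk with rfl | hk
    · simp [hσj]
    · rw [hf k hk]
      exact ⟨(h3 k hk).1, Or.inr (Or.inr (h3 k hk).2)⟩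
  · rw [Finset.sum_insert hiS, Function.update_self,
      Finset.sum_congr rfl (fun k hk => by rw [hf k hk])]
    linarith

theorem hasMatching_greedyScore (w : ι → ℝ) (σ : ι → Bool) : ∀ (i : ι) (l : List ι),
    (i :: l).Nodup → (i :: l).Pairwise (fun j k => w k ≤ w j) →
    HasMatching w σ (· ∈ i :: l) ((greedyScore w σ (σ i) l + (l.map w).sum) / 3)
  | i, [], _, _ => by
    simpa [greedyScore] using hasMatching_zero w σ (· ∈ [i])
  | i, [a], hn, hw => by
    have hwa : w a ≤ w i := by simpa using hw
    have hia : i ≠ a := by simpa using hn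
    by_cases hc : σ a ≠ σ i
    · refine ((hasMatching_zero w σ (fun _ => False)).insert (i := i) (j := a) id id
        hc.symm).mono (fun k hk => by simpa using hk) ?_
      rw [min_eq_right hwa]
      simp only [greedyScore, if_pos hc, List.map_cons, List.map_nil, List.sum_cons, List.sum_nil]
      linarith
    · refine (hasMatching_zero w σ _).mono (fun k hk => hk) ?_
      simp only [greedyScore, if_neg hc, List.map_cons, List.map_nil, List.sum_cons, List.sum_nil]
      linarith
  | i, a :: b :: l, hn, hw => by
    have hn' := hn
    have hw' := hw
    simp only [List.nodup_cons, List.mem_cons, not_or] at hn'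
    simp only [List.pairwise_cons, List.mem_cons, forall_eq_or_imp] at hw'
    obtain ⟨⟨hia, hib, hil⟩, ⟨hab, hal⟩, hbl, hl⟩ := hn'
    obtain ⟨⟨hwa, hwb, hwl⟩, ⟨hwab, -⟩, hwbl, hwll⟩ := hw'
    simp only [greedyScore, List.map_cons, List.sum_cons]
    have hIH := hasMatching_greedyScore w σ i l (by simp [hil, hl])
      (List.pairwise_cons.2 ⟨hwl, hwll⟩)
    by_cases hc : σ a ≠ σ i
    · have hIH' := hasMatching_greedyScore w σ b l (by simp [hbl, hl])
        (List.pairwise_cons.2 ⟨hwbl, hwll⟩)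
      refine (hIH'.insert (i := i) (j := a) (by simp [hib, hil]) (by simp [hab, hal])
        hc.symm).mono (fun k hk => by simpa using hk) ?_
      rw [min_eq_right hwa, if_pos hc]
      linarith
    · rw [if_neg hc]
      by_cases hd : σ b ≠ σ i
      · have hab' : σ a ≠ σ b := by rw [not_not.1 hc]; exact hd.symm
        refine (hIH.insert (i := a) (j := b) (by simp [Ne.symm hia, hal])
          (by simp [Ne.symm hib, hbl]) hab').mono
          (fun k hk => by simp only [List.mem_cons] at hk ⊢; tauto) ?_
        rw [min_eq_right hwab, if_pos hd]
        linarith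
      · refine hIH.mono (fun k hk => by simp only [List.mem_cons] at hk ⊢; tauto) ?_
        rw [if_neg hd]
        linarith

/-- Reversing the side of the index `a`. -/
def flipAt (a : ι) (σ : ι → Bool) : ι → Bool := Function.update σ a (!σ a)

theorem flipAt_self (a : ι) (σ : ι → Bool) : flipAt a σ a = !σ a := by simp [flipAt]

theorem flipAt_of_ne {a k : ι} (h : k ≠ a) (σ : ι → Bool) : flipAt a σ k = σ k := by
  simp [flipAt, h]

theorem flipAt_flipAt (a : ι) (σ : ι → Bool) : flipAt a (flipAt a σ) = σ := by
  simp [flipAt]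

theorem greedyScore_flipAt (w : ι → ℝ) {a i : ι} (hai : i ≠ a) {l : List ι} (hal : a ∉ l)
    (σ : ι → Bool) : greedyScore w (flipAt a σ) (flipAt a σ i) l = greedyScore w σ (σ i) l := by
  rw [flipAt_of_ne hai]
  exact greedyScore_congr w _ l fun k hk => flipAt_of_ne (ne_of_mem_of_not_mem hk hal) σ

variable [Fintype ι]

/-- The number of assignments of sides satisfying `P`. -/
noncomputable def numOutcomes (P : (ι → Bool) → Prop) : ℕ :=
  (@Finset.filter (ι → Bool) P (Classical.decPred _) univ).card

theorem numOutcomes_const (p : Prop) [Decidable p] :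
    numOutcomes (fun _ : ι → Bool => p) = if p then Fintype.card (ι → Bool) else 0 := by
  by_cases hp : p <;> simp [numOutcomes, hp]

theorem numOutcomes_mono {P Q : (ι → Bool) → Prop} (h : ∀ σ, P σ → Q σ) :
    numOutcomes P ≤ numOutcomes Q := by
  classical
  refine Finset.card_le_card fun σ hσ => ?_
  rw [Finset.mem_filter] at hσ ⊢
  exact ⟨hσ.1, h σ hσ.2⟩

theorem numOutcomes_ne_and_eq_numOutcomes_eq_and {a i : ι} (hai : a ≠ i) {P : (ι → Bool) → Prop}
    (hP : ∀ σ, P (flipAt a σ) ↔ P σ) :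
    numOutcomes (fun σ => σ a ≠ σ i ∧ P σ) = numOutcomes (fun σ => ¬ σ a ≠ σ i ∧ P σ) := by
  refine Finset.card_bij' (fun σ _ => flipAt a σ) (fun σ _ => flipAt a σ) ?_ ?_
    (fun σ _ => flipAt_flipAt a σ) (fun σ _ => flipAt_flipAt a σ)
  all_goals
    intro σ hσ
    simp only [Finset.mem_filter, Finset.mem_univ, true_and, flipAt_self,
      flipAt_of_ne hai.symm, hP] at hσ ⊢
    refine ⟨?_, hσ.2⟩
    have := hσ.1
    cases h1 : σ a <;> cases h2 : σ i <;> simp_all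

theorem numOutcomes_and_add_numOutcomes_not_and (A P : (ι → Bool) → Prop) :
    numOutcomes (fun σ => A σ ∧ P σ) + numOutcomes (fun σ => ¬ A σ ∧ P σ) = numOutcomes P := by
  classical
  have := Finset.card_filter_add_card_filter_not (s := {σ : ι → Bool | P σ}) A
  rw [Finset.filter_filter, Finset.filter_filter] at this
  simp only [and_comm (a := A _), and_comm (a := ¬ A _), numOutcomes]
  convert this

theorem two_mul_numOutcomes_ne_and {a i : ι} (hai : a ≠ i) {P : (ι → Bool) → Prop}
    (hP : ∀ σ, P (flipAt a σ) ↔ P σ) :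
    2 * numOutcomes (fun σ => σ a ≠ σ i ∧ P σ) = numOutcomes P := by
  have h1 := numOutcomes_ne_and_eq_numOutcomes_eq_and hai hP
  have h2 := numOutcomes_and_add_numOutcomes_not_and (fun σ => σ a ≠ σ i) P
  omega

theorem two_mul_numOutcomes_not_ne_and {a i : ι} (hai : a ≠ i) {P : (ι → Bool) → Prop}
    (hP : ∀ σ, P (flipAt a σ) ↔ P σ) :
    2 * numOutcomes (fun σ => ¬ σ a ≠ σ i ∧ P σ) = numOutcomes P := by
  rw [← numOutcomes_ne_and_eq_numOutcomes_eq_and hai hP, two_mul_numOutcomes_ne_and hai hP]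

theorem numOutcomes_greedyScore_lt (w : ι → ℝ) : ∀ (i : ι) (l : List ι), (i :: l).Nodup → ∀ x : ℝ,
    (numOutcomes (fun σ => greedyScore w σ (σ i) l < x) : ℝ) =
      Fintype.card (ι → Bool) * scoreDist (l.map w) x
  | i, [], _, x => by
    by_cases hx : 0 < x <;> simp [greedyScore, scoreDist, hx, numOutcomes_const]
  | i, [a], hn, x => by
    have hai : a ≠ i := by simpa [eq_comm] using hn
    have h1 := two_mul_numOutcomes_ne_and hai (P := fun _ => 0 < x - 2 * w a) (fun _ => Iff.rfl)
    have h2 := two_mul_numOutcomes_not_ne_and hai (P := fun _ => 0 < x + w a) (fun _ => Iff.rfl)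
    have h0 := numOutcomes_and_add_numOutcomes_not_and (fun σ => σ a ≠ σ i)
      (fun σ => greedyScore w σ (σ i) [a] < x)
    have e1 : numOutcomes (fun σ => σ a ≠ σ i ∧ greedyScore w σ (σ i) [a] < x) =
        numOutcomes (fun σ => σ a ≠ σ i ∧ 0 < x - 2 * w a) := by
      congr 1 with σ
      refine and_congr_right fun h => ?_
      rw [greedyScore, if_pos h, sub_pos]
    have e2 : numOutcomes (fun σ => ¬ σ a ≠ σ i ∧ greedyScore w σ (σ i) [a] < x) =
        numOutcomes (fun σ => ¬ σ a ≠ σ i ∧ 0 < x + w a) := by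
      congr 1 with σ
      refine and_congr_right fun h => ?_
      rw [greedyScore, if_neg h, neg_lt_iff_pos_add]
    have c : ∀ y : ℝ, (numOutcomes (fun _ : ι → Bool => 0 < y) : ℝ) =
        Fintype.card (ι → Bool) * scoreDist [] y := by
      intro y
      by_cases hy : 0 < y <;> simp [scoreDist, hy, numOutcomes_const]
    rw [e1, e2] at h0
    rify at h0 h1 h2
    rw [c] at h1 h2
    simp only [List.map_cons, List.map_nil, scoreDist.eq_2, pairStep, mul_zero, add_zero, sub_zero]
    linarith
  | i, a :: b :: l, hn, x => by
    have hn' := hn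
    simp only [List.nodup_cons, List.mem_cons, not_or] at hn'
    obtain ⟨⟨hia, hib, hil⟩, ⟨hab, hal⟩, hbl, hl⟩ := hn'
    have IHb := numOutcomes_greedyScore_lt w b l (by simp [hbl, hl]) (x - 2 * w a + w b)
    have IH1 := numOutcomes_greedyScore_lt w i l (by simp [hil, hl]) (x + w a - 2 * w b)
    have IH2 := numOutcomes_greedyScore_lt w i l (by simp [hil, hl]) (x + w a + w b)
    have h0 := numOutcomes_and_add_numOutcomes_not_and (fun σ => σ a ≠ σ i)
      (fun σ => greedyScore w σ (σ i) (a :: b :: l) < x)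
    have e1 : numOutcomes (fun σ => σ a ≠ σ i ∧ greedyScore w σ (σ i) (a :: b :: l) < x) =
        numOutcomes (fun σ => σ a ≠ σ i ∧ greedyScore w σ (σ b) l < x - 2 * w a + w b) := by
      congr 1 with σ
      refine and_congr_right fun h => ?_
      rw [greedyScore, if_pos h]
      constructor <;> intro h <;> linarith
    have h1 := two_mul_numOutcomes_ne_and (Ne.symm hia)
      (P := fun σ => greedyScore w σ (σ b) l < x - 2 * w a + w b)
      (fun σ => by rw [greedyScore_flipAt w (Ne.symm hab) hal])
    have e2 : numOutcomes (fun σ => ¬ σ a ≠ σ i ∧ greedyScore w σ (σ i) (a :: b :: l) < x) =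
        numOutcomes (fun σ => ¬ σ a ≠ σ i ∧
          (σ b ≠ σ i ∧ greedyScore w σ (σ i) l < x + w a - 2 * w b ∨
            ¬ σ b ≠ σ i ∧ greedyScore w σ (σ i) l < x + w a + w b)) := by
      congr 1 with σ
      refine and_congr_right fun h => ?_
      rw [greedyScore, if_neg h]
      by_cases hd : σ b ≠ σ i
      · rw [if_pos hd]
        simp only [hd, ne_eq, not_false_eq_true, true_and, not_true_eq_false, false_and, or_false]
        constructor <;> intro h <;> linarith
      · rw [if_neg hd]
        simp only [hd, false_and, not_false_eq_true, true_and, false_or]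
        constructor <;> intro h <;> linarith
    have h2 := two_mul_numOutcomes_not_ne_and (Ne.symm hia)
      (P := fun σ => σ b ≠ σ i ∧ greedyScore w σ (σ i) l < x + w a - 2 * w b ∨
            ¬ σ b ≠ σ i ∧ greedyScore w σ (σ i) l < x + w a + w b)
      (fun σ => by
        rw [greedyScore_flipAt w hia hal, flipAt_of_ne (Ne.symm hab), flipAt_of_ne hia])
    have h3 := numOutcomes_and_add_numOutcomes_not_and (fun σ => σ b ≠ σ i)
      (fun σ => σ b ≠ σ i ∧ greedyScore w σ (σ i) l < x + w a - 2 * w b ∨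
            ¬ σ b ≠ σ i ∧ greedyScore w σ (σ i) l < x + w a + w b)
    have e3 : numOutcomes (fun σ => σ b ≠ σ i ∧
          (σ b ≠ σ i ∧ greedyScore w σ (σ i) l < x + w a - 2 * w b ∨
            ¬ σ b ≠ σ i ∧ greedyScore w σ (σ i) l < x + w a + w b)) =
        numOutcomes (fun σ => σ b ≠ σ i ∧ greedyScore w σ (σ i) l < x + w a - 2 * w b) := by
      congr 1 with σ
      tauto
    have e4 : numOutcomes (fun σ => ¬ σ b ≠ σ i ∧
          (σ b ≠ σ i ∧ greedyScore w σ (σ i) l < x + w a - 2 * w b ∨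
            ¬ σ b ≠ σ i ∧ greedyScore w σ (σ i) l < x + w a + w b)) =
        numOutcomes (fun σ => ¬ σ b ≠ σ i ∧ greedyScore w σ (σ i) l < x + w a + w b) := by
      congr 1 with σ
      tauto
    have h4 := two_mul_numOutcomes_ne_and (Ne.symm hib)
      (P := fun σ => greedyScore w σ (σ i) l < x + w a - 2 * w b)
      (fun σ => by rw [greedyScore_flipAt w hib hbl])
    have h5 := two_mul_numOutcomes_not_ne_and (Ne.symm hib)
      (P := fun σ => greedyScore w σ (σ i) l < x + w a + w b)
      (fun σ => by rw [greedyScore_flipAt w hib hbl])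
    rw [e1, e2] at h0
    rw [e3, e4] at h3
    rify at h0 h1 h2 h3 h4 h5
    simp only [List.map_cons, scoreDist.eq_3, pairStep]
    linarith

end Greedy

/-- Lemma 3: if positive weights `w₁, …, w_ℓ` of total `W` satisfy `wᵢ < W/ρ` for all `i`
(with `ρ ≥ 1`) and each index is placed independently and uniformly at random into one of
two sets (`σ i = true` meaning side `A`, `σ i = false` meaning side `B`), then with
probability at least `1/2` (i.e. for at least half of the `2^ℓ` outcomes) there is a
matching between the two sides — a subset `S` of side `A` and an injection `f` from `S`
into side `B` — of weight `∑_{i ∈ S} min (wᵢ, w_{f i}) > (W/3)(1 − 1/ρ)`. -/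
theorem matching_concentration (ℓ : ℕ) (hℓ : 1 ≤ ℓ) (w : Fin ℓ → ℝ)
    (hw : ∀ i, 0 < w i) (ρ : ℝ) (hρ : 1 ≤ ρ)
    (hsmall : ∀ i, w i < (∑ j, w j) / ρ) :
    2 * (@Finset.filter (Fin ℓ → Bool)
        (fun σ => ∃ (S : Finset (Fin ℓ)) (f : Fin ℓ → Fin ℓ),
          (∀ i ∈ S, σ i = true) ∧ Set.InjOn f S ∧ (∀ i ∈ S, σ (f i) = false) ∧
          (∑ i ∈ S, min (w i) (w (f i))) > (∑ j, w j) / 3 * (1 - 1 / ρ))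
        (Classical.decPred _) univ).card
      ≥ Fintype.card (Fin ℓ → Bool) := by
  obtain ⟨L, hperm, hsorted⟩ : ∃ L : List (Fin ℓ), L.Perm (List.finRange ℓ) ∧
      L.Pairwise (fun j k => w k ≤ w j) := by
    let r : Fin ℓ → Fin ℓ → Prop := fun j k => w k ≤ w j
    have : Std.Total r := ⟨fun j k => le_total _ _⟩
    have : IsTrans (Fin ℓ) r := ⟨fun i j k h1 h2 => le_trans h2 h1⟩
    exact ⟨(List.finRange ℓ).insertionSort r, List.perm_insertionSort r _,
      List.pairwise_insertionSort r _⟩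
  have hnodup : L.Nodup := hperm.nodup_iff.2 (List.nodup_finRange ℓ)
  have hsum : (L.map w).sum = ∑ j, w j := by
    rw [(hperm.map w).sum_eq, ← List.ofFn_eq_map, List.sum_ofFn]
  obtain _ | ⟨i, l⟩ := L
  · have := hperm.length_eq
    simp only [List.length_nil, List.length_finRange] at this
    omega
  rw [List.map_cons, List.sum_cons] at hsum
  have hdist : scoreDist (l.map w) 0 ≤ 1 / 2 := by
    have := isTame_scoreDist (l.map w)
      (fun x hx => by
        obtain ⟨j, -, rfl⟩ := List.mem_map.1 hx
        exact (hw j).le)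
      (List.pairwise_map.2 (List.pairwise_cons.1 hsorted).2) 0 0 0 le_rfl le_rfl (by norm_num)
    linarith
  have hcard := numOutcomes_greedyScore_lt w i l hnodup 0
  have hsplit := numOutcomes_and_add_numOutcomes_not_and
    (fun σ => greedyScore w σ (σ i) l < 0) (fun _ => True)
  simp only [and_true, numOutcomes_const, if_true] at hsplit
  have hbad : 2 * numOutcomes (fun σ => greedyScore w σ (σ i) l < 0) ≤
      Fintype.card (Fin ℓ → Bool) := by
    have hpos : (0 : ℝ) ≤ Fintype.card (Fin ℓ → Bool) := Nat.cast_nonneg _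
    have : 2 * (numOutcomes (fun σ => greedyScore w σ (σ i) l < 0) : ℝ) ≤
        Fintype.card (Fin ℓ → Bool) := by
      rw [hcard]
      nlinarith
    exact_mod_cast this
  change 2 * numOutcomes _ ≥ _
  refine le_trans ?_ (Nat.mul_le_mul_left 2 (numOutcomes_mono
    (P := fun σ => ¬ greedyScore w σ (σ i) l < 0) fun σ hσ => ?_))
  · omega
  · obtain ⟨S, f, h1, h2, h3, h4⟩ := hasMatching_greedyScore w σ i l hnodup hsorted
    refine ⟨S, f, fun j hj => (h1 j hj).1, h2, fun j hj => (h3 j hj).1, ?_⟩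
    have h5 : (∑ j, w j) / 3 * (1 - 1 / ρ) = ((∑ j, w j) - (∑ j, w j) / ρ) / 3 := by ring
    rw [gt_iff_lt, h5]
    linarith [hsmall i, hσ]
end

section
/- Let there be n bidders with values v_i > 0 and k slots with CTRs α₁ ≥ … ≥ α_k ≥ 0 (plus a dummy slot of CTR 0), and suppose v_i·α₁ < OPT({1,…,n})/36 for every bidder i. If each bidder is placed independently and uniformly at random into one of two sets S₁ and S₂, then with probability at least 3/4 both OPT(S₁) ≥ OPT({1,…,n})/3 and OPT(S₂) ≥ OPT({1,…,n})/3 hold. (Lemma 5.) -/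
open Finset

/-- Optimal social welfare obtained by auctioning only the bidders in `S`: the supremum,
over assignments giving each non-dummy slot to at most one bidder of `S`, of the welfare
of the bidders in `S`. -/
noncomputable def OPTon (n k : ℕ) (α : Fin k → ℝ) (v : Fin n → ℝ)
    (S : Finset (Fin n)) : ℝ :=
  sSup {t : ℝ | ∃ π : Fin n → Fin (k + 1),
    (∀ i ∈ S, ∀ j ∈ S, π i = π j → (π i : ℕ) < k → i = j) ∧
    t = ∑ i ∈ S, v i * ctr k α (π i)}

/-- The set of welfares attained by feasible assignments of the bidders in `S`. -/
def welfareSet (n k : ℕ) (α : Fin k → ℝ) (v : Fin n → ℝ) (S : Finset (Fin n)) : Set ℝ :=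
  {t : ℝ | ∃ π : Fin n → Fin (k + 1),
    (∀ i ∈ S, ∀ j ∈ S, π i = π j → (π i : ℕ) < k → i = j) ∧
    t = ∑ i ∈ S, v i * ctr k α (π i)}

theorem welfareSet_finite (n k : ℕ) (α : Fin k → ℝ) (v : Fin n → ℝ) (S : Finset (Fin n)) :
    (welfareSet n k α v S).Finite := by
  refine (Set.finite_range fun π : Fin n → Fin (k + 1) => ∑ i ∈ S, v i * ctr k α (π i)).subset ?_
  rintro t ⟨π, -, rfl⟩
  exact ⟨π, rfl⟩

theorem exists_assignment_eq_OPTon (n k : ℕ) (α : Fin k → ℝ) (v : Fin n → ℝ)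
    (S : Finset (Fin n)) :
    ∃ π : Fin n → Fin (k + 1),
      (∀ i ∈ S, ∀ j ∈ S, π i = π j → (π i : ℕ) < k → i = j) ∧
      OPTon n k α v S = ∑ i ∈ S, v i * ctr k α (π i) := by
  have hne : (welfareSet n k α v S).Nonempty :=
    ⟨_, fun _ => Fin.last k, by simp, rfl⟩
  exact hne.csSup_mem (welfareSet_finite n k α v S)

theorem welfare_le_OPTon {n k : ℕ} {α : Fin k → ℝ} {v : Fin n → ℝ} {S : Finset (Fin n)}
    {π : Fin n → Fin (k + 1)}
    (hπ : ∀ i ∈ S, ∀ j ∈ S, π i = π j → (π i : ℕ) < k → i = j) :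
    ∑ i ∈ S, v i * ctr k α (π i) ≤ OPTon n k α v S :=
  le_csSup (welfareSet_finite n k α v S).bddAbove ⟨π, hπ, rfl⟩

theorem ctr_le_first {k : ℕ} (hk : 0 < k) {α : Fin k → ℝ} (hα : ∀ j, 0 ≤ α j)
    (hmono : ∀ j j' : Fin k, j ≤ j' → α j' ≤ α j) (j : Fin (k + 1)) :
    ctr k α j ≤ α ⟨0, hk⟩ := by
  unfold ctr
  split_ifs
  exacts [hmono _ _ (Nat.zero_le _), hα _]

/-- The sign `1` or `-1` attached to a side of the partition. -/
def boolSign (b : Bool) : ℝ := if b then 1 else -1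

theorem boolSign_not (b : Bool) : boolSign (!b) = -boolSign b := by
  cases b <;> simp [boolSign]

theorem boolSign_mul_self (b : Bool) : boolSign b * boolSign b = 1 := by
  cases b <;> simp [boolSign]

theorem sum_boolSign_mul_boolSign {ι : Type*} [Fintype ι] [DecidableEq ι] (i j : ι) :
    ∑ σ : ι → Bool, boolSign (σ i) * boolSign (σ j) =
      if i = j then (Fintype.card (ι → Bool) : ℝ) else 0 := by
  split_ifs with hij
  · subst hij
    simp [boolSign_mul_self]
  · have hinv : Function.Involutive fun σ : ι → Bool => Function.update σ i (!σ i) := by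
      intro σ
      simp
    have hflip := Equiv.sum_comp hinv.toPerm fun σ => boolSign (σ i) * boolSign (σ j)
    simp only [Function.Involutive.coe_toPerm, Function.update_self,
      Function.update_of_ne (Ne.symm hij), boolSign_not, neg_mul, sum_neg_distrib] at hflip
    linarith

/-- Second moment of a Rademacher sum. -/
theorem sum_sq_sum_boolSign {ι : Type*} [Fintype ι] [DecidableEq ι] (w : ι → ℝ) :
    ∑ σ : ι → Bool, (∑ i, w i * boolSign (σ i)) ^ 2 =
      Fintype.card (ι → Bool) * ∑ i, w i ^ 2 := by
  calc ∑ σ : ι → Bool, (∑ i, w i * boolSign (σ i)) ^ 2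
      = ∑ σ : ι → Bool, ∑ i, ∑ j, w i * w j * (boolSign (σ i) * boolSign (σ j)) := by
        simp only [sq, sum_mul_sum, mul_mul_mul_comm]
    _ = ∑ i, ∑ j, w i * w j * ∑ σ : ι → Bool, boolSign (σ i) * boolSign (σ j) := by
        rw [sum_comm]
        refine sum_congr rfl fun i _ => ?_
        rw [sum_comm]
        simp only [mul_sum]
    _ = Fintype.card (ι → Bool) * ∑ i, w i ^ 2 := by
        simp only [sum_boolSign_mul_boolSign, mul_ite, mul_zero, sum_ite_eq, mem_univ, if_true,
          mul_sum]
        exact sum_congr rfl fun i _ => by ring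

/-- Chebyshev's inequality for a Rademacher sum, in counting form. -/
theorem card_lt_abs_sum_boolSign_mul_sq_le {ι : Type*} [Fintype ι] [DecidableEq ι] (w : ι → ℝ) {c : ℝ}
    (hc : 0 ≤ c) :
    (#{σ : ι → Bool | c < |∑ i, w i * boolSign (σ i)|} : ℝ) * c ^ 2 ≤
      Fintype.card (ι → Bool) * ∑ i, w i ^ 2 := by
  rw [← sum_sq_sum_boolSign, ← nsmul_eq_mul, ← sum_const]
  calc ∑ σ : ι → Bool with c < |∑ i, w i * boolSign (σ i)|, c ^ 2
      ≤ ∑ σ : ι → Bool with c < |∑ i, w i * boolSign (σ i)|,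
          (∑ i, w i * boolSign (σ i)) ^ 2 := by
        refine sum_le_sum fun σ hσ => ?_
        rw [← sq_abs (∑ i, w i * boolSign (σ i))]
        exact pow_le_pow_left₀ hc (mem_filter.1 hσ).2.le 2
    _ ≤ ∑ σ : ι → Bool, (∑ i, w i * boolSign (σ i)) ^ 2 :=
        sum_le_sum_of_subset_of_nonneg (filter_subset _ _) fun _ _ _ => sq_nonneg _

theorem sum_boolSign_eq_sub {ι : Type*} [Fintype ι] (w : ι → ℝ) (σ : ι → Bool) :
    ∑ i, w i * boolSign (σ i) =
      ∑ i with σ i = true, w i - ∑ i with σ i = false, w i := by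
  rw [sum_filter, sum_filter, ← sum_sub_distrib]
  refine sum_congr rfl fun i _ => ?_
  cases σ i <;> simp [boolSign]

theorem sum_true_add_sum_false {ι : Type*} [Fintype ι] (w : ι → ℝ) (σ : ι → Bool) :
    ∑ i with σ i = true, w i + ∑ i with σ i = false, w i = ∑ i, w i := by
  rw [sum_filter, sum_filter, ← sum_add_distrib]
  refine sum_congr rfl fun i _ => ?_
  cases σ i <;> simp

/-- If every weight is at most `1/36` of the total, then at least three quarters of all
two-colourings give each colour at least a third of the total weight. -/
theorem three_quarters_balanced {ι : Type*} [Fintype ι] [DecidableEq ι] (w : ι → ℝ) (hw : ∀ i, 0 ≤ w i)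
    (hsmall : ∀ i, w i ≤ (∑ j, w j) / 36) :
    3 * Fintype.card (ι → Bool) ≤
      4 * #{σ : ι → Bool | |∑ i, w i * boolSign (σ i)| ≤ (∑ i, w i) / 3} := by
  have hsplit := card_filter_add_card_filter_not (s := (univ : Finset (ι → Bool)))
    fun σ => |∑ i, w i * boolSign (σ i)| ≤ (∑ i, w i) / 3
  simp only [not_le, card_univ] at hsplit
  suffices h : 4 * #{σ : ι → Bool | (∑ i, w i) / 3 < |∑ i, w i * boolSign (σ i)|} ≤
      Fintype.card (ι → Bool) by omega
  set W := ∑ i, w i with hW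
  rcases (sum_nonneg fun i _ => hw i : 0 ≤ ∑ i, w i).eq_or_lt with h0 | hpos
  · have hzero : ∀ i, w i = 0 := fun i =>
      (sum_eq_zero_iff_of_nonneg fun i _ => hw i).1 h0.symm i (mem_univ i)
    simp [hW, hzero]
  · rw [← hW] at hpos
    have hsq : ∑ i, w i ^ 2 ≤ W * (W / 36) := by
      rw [hW, sum_mul]
      exact sum_le_sum fun i _ => by
        rw [sq]
        exact mul_le_mul_of_nonneg_left (hsmall i) (hw i)
    have hcheb := (card_lt_abs_sum_boolSign_mul_sq_le w (div_nonneg hpos.le zero_le_three)).trans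
      (mul_le_mul_of_nonneg_left hsq (Nat.cast_nonneg _))
    have hreal : (4 * #{σ : ι → Bool | W / 3 < |∑ i, w i * boolSign (σ i)|} : ℝ) ≤
        Fintype.card (ι → Bool) := by
      refine le_of_mul_le_mul_right ?_ (pow_pos hpos 2)
      linarith
    exact_mod_cast hreal

/-- Lemma 5: under the large-market assumption `vᵢ·α₁ < OPT/36` for every bidder, if each
bidder is placed independently and uniformly at random into one of the two sets
`S₁ = σ⁻¹(true)` and `S₂ = σ⁻¹(false)`, then with probability at least `3/4` (i.e. for at
least three quarters of the `2^n` outcomes) both `OPT(S₁) ≥ OPT/3` and `OPT(S₂) ≥ OPT/3`. -/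
theorem sampled_opt_concentration (n k : ℕ) (hk : 0 < k)
    (α : Fin k → ℝ) (hα : ∀ j, 0 ≤ α j)
    (hmono : ∀ j j' : Fin k, j ≤ j' → α j' ≤ α j)
    (v : Fin n → ℝ) (hv : ∀ i, 0 < v i)
    (hsmall : ∀ i, v i * α ⟨0, hk⟩ < OPTon n k α v univ / 36) :
    4 * (@Finset.filter (Fin n → Bool)
        (fun σ =>
          OPTon n k α v (univ.filter (fun i => σ i = true)) ≥ OPTon n k α v univ / 3 ∧
          OPTon n k α v (univ.filter (fun i => σ i = false)) ≥ OPTon n k α v univ / 3)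
        (Classical.decPred _) univ).card
      ≥ 3 * Fintype.card (Fin n → Bool) := by
  obtain ⟨π, hπ, hopt⟩ := exists_assignment_eq_OPTon n k α v univ
  set w : Fin n → ℝ := fun i => v i * ctr k α (π i) with hw
  have hsub : ∀ S : Finset (Fin n), ∑ i ∈ S, w i ≤ OPTon n k α v S := fun S =>
    welfare_le_OPTon fun i _ j _ => hπ i (mem_univ i) j (mem_univ j)
  have hbal := three_quarters_balanced w
    (fun i => mul_nonneg (hv i).le (ctr_nonneg hα _)) fun i => by
      rw [← hopt]
      exact (mul_le_mul_of_nonneg_left (ctr_le_first hk hα hmono _) (hv i).le).trans (hsmall i).le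
  refine hbal.trans (Nat.mul_le_mul_left 4 (card_le_card fun σ hσ => ?_))
  simp only [mem_filter, mem_univ, true_and] at hσ ⊢
  rw [sum_boolSign_eq_sub, abs_le] at hσ
  have hadd := sum_true_add_sum_false w σ
  have htrue := hsub (univ.filter fun i => σ i = true)
  have hfalse := hsub (univ.filter fun i => σ i = false)
  rw [hopt]
  constructor <;> linarith [hσ.1, hσ.2]
end
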